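/- arXiv:2210.08680 — 2 statements merged into one kernel-verified Lean document; each statement's English description precedes it below -/
import Mathlib

section
/- For every fixed local dimension d there is a constant C (depending only on d) such that: for every 2-local Hamiltonian H = ∑_{e∈E} h_e on n qudits of local dimension d and every integer 1 ≤ l ≤ n, there exists a product mixed state σ = ⊗_{u=1}^n σ_u such that f(σ) ≥ F ≥ f(σ) − C·( (l/n)·|J|_1 + (n/√l)·‖J‖_F ), where J is the array of interaction strengths J_e = ‖h_e‖_∞. -/
open scoped BigOperators ComplexOrder

noncomputable section

namespace QLH

/-- The operator (spectral) norm of a square complex matrix. -/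
def opNorm {m : Type*} [Fintype m] [DecidableEq m] (A : Matrix m m ℂ) : ℝ :=
  ‖Matrix.toEuclideanCLM (𝕜 := ℂ) A‖

/-- A density matrix: positive semidefinite with unit trace. -/
def IsDensity {m : Type*} [Fintype m] (ρ : Matrix m m ℂ) : Prop :=
  ρ.PosSemidef ∧ ρ.trace = 1

/-- The (real) energy `Tr[Hρ]`. -/
def energy {m : Type*} [Fintype m] (H ρ : Matrix m m ℂ) : ℝ :=
  ((H * ρ).trace).re

/-- Von Neumann entropy via eigenvalues. -/
def entropy {m : Type*} [Fintype m] [DecidableEq m] (ρ : Matrix m m ℂ) : ℝ :=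
  if h : ρ.IsHermitian then -∑ i, h.eigenvalues i * Real.log (h.eigenvalues i) else 0

/-- The free-energy functional at inverse temperature `β`. -/
def freeEnergyFun {m : Type*} [Fintype m] [DecidableEq m] (β : ℝ) (H ρ : Matrix m m ℂ) : ℝ :=
  energy H ρ - entropy ρ / β

/-- The free energy: the infimum of the free-energy functional over density matrices. -/
def freeEnergy {m : Type*} [Fintype m] [DecidableEq m] (β : ℝ) (H : Matrix m m ℂ) : ℝ :=
  sInf {x : ℝ | ∃ ρ, IsDensity ρ ∧ x = freeEnergyFun β H ρ}

/-- `A` acts (nontrivially) only on the sites in `e`. -/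
def ActsOn {n : ℕ} {α : Type*} [Fintype α] [DecidableEq α]
    (A : Matrix (Fin n → α) (Fin n → α) ℂ) (e : Finset (Fin n)) : Prop :=
  ∃ M : Matrix ({u // u ∈ e} → α) ({u // u ∈ e} → α) ℂ,
    ∀ x y, A x y =
      (if ∀ u ∉ e, x u = y u then (1 : ℂ) else 0) *
        M (fun u => x u.1) (fun u => y u.1)

/-- Tensor-product (product) state built from single-site matrices. -/
def prodState {n : ℕ} {α : Type*} [Fintype α] (σ : Fin n → Matrix α α ℂ) :
    Matrix (Fin n → α) (Fin n → α) ℂ :=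
  fun x y => ∏ u, σ u (x u) (y u)

/-- A separable state: a finite convex combination of product states. -/
def IsSeparable {n : ℕ} {α : Type*} [Fintype α] [DecidableEq α]
    (σ : Matrix (Fin n → α) (Fin n → α) ℂ) : Prop :=
  ∃ (N : ℕ) (p : Fin N → ℝ) (τ : Fin N → Fin n → Matrix α α ℂ),
    (∀ i, 0 ≤ p i) ∧ (∑ i, p i = 1) ∧ (∀ i u, IsDensity (τ i u)) ∧
    σ = ∑ i, (p i : ℂ) • prodState (τ i)


set_option linter.unusedSectionVars false

section Prod
variable {n : ℕ} {α : Type*} [Fintype α] [DecidableEq α]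

lemma prodState_mul (X Y : Fin n → Matrix α α ℂ) :
    prodState X * prodState Y = prodState (fun u => X u * Y u) := by
  ext x y
  simp only [prodState, Matrix.mul_apply, ← Finset.prod_mul_distrib]
  rw [Finset.prod_univ_sum]
  simp

lemma prodState_conjTranspose (X : Fin n → Matrix α α ℂ) :
    (prodState X).conjTranspose = prodState (fun u => (X u).conjTranspose) := by
  ext x y
  simp [prodState, Matrix.conjTranspose_apply]

lemma trace_prodState (X : Fin n → Matrix α α ℂ) :
    (prodState X).trace = ∏ u, (X u).trace := by
  simp only [prodState, Matrix.trace, Matrix.diag]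
  rw [Finset.prod_univ_sum]
  simp

lemma prodState_one : prodState (fun _ : Fin n => (1 : Matrix α α ℂ)) = 1 := by
  ext x y
  simp only [prodState, Matrix.one_apply]
  by_cases h : x = y
  · simp [h]
  · rw [if_neg h]
    obtain ⟨u, hu⟩ := Function.ne_iff.mp h
    exact Finset.prod_eq_zero (Finset.mem_univ u) (by simp [hu])

lemma sum_prodState {κ : Type*} [Fintype κ] (M : Fin n → κ → Matrix α α ℂ) :
    ∑ k : Fin n → κ, prodState (fun u => M u (k u)) = prodState (fun u => ∑ i, M u i) := by
  ext x y
  simp only [prodState, Matrix.sum_apply]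
  rw [Finset.prod_univ_sum]
  simp

lemma smul_prodState (c : Fin n → ℂ) (M : Fin n → Matrix α α ℂ) :
    (∏ u, c u) • prodState M = prodState (fun u => c u • M u) := by
  ext x y
  simp [prodState, Finset.prod_mul_distrib]

lemma prodState_update_apply (X : Fin n → Matrix α α ℂ) (v : Fin n) (Z : Matrix α α ℂ)
    (x y : Fin n → α) :
    prodState (Function.update X v Z) x y =
      Z (x v) (y v) * ∏ u ∈ Finset.univ.erase v, X u (x u) (y u) := by
  simp only [prodState]
  rw [← Finset.mul_prod_erase Finset.univ _ (Finset.mem_univ v)]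
  congr 1
  · simp
  · apply Finset.prod_congr rfl
    intro u hu
    rw [Function.update_of_ne (Finset.ne_of_mem_erase hu)]

lemma prodState_update_sum {κ : Type*} (s : Finset κ) (c : κ → ℂ) (X : Fin n → Matrix α α ℂ)
    (v : Fin n) (Z : κ → Matrix α α ℂ) :
    prodState (Function.update X v (∑ i ∈ s, c i • Z i)) =
      ∑ i ∈ s, c i • prodState (Function.update X v (Z i)) := by
  ext x y
  simp only [Matrix.sum_apply, Matrix.smul_apply, prodState_update_apply, smul_eq_mul,
    Finset.sum_mul, mul_assoc]

lemma exists_conjTranspose_mul_self {m : Type*} [Fintype m] [DecidableEq m] {A : Matrix m m ℂ}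
    (hA : A.PosSemidef) : ∃ Y : Matrix m m ℂ, A = Y.conjTranspose * Y := by
  open scoped MatrixOrder in
  have := (CStarAlgebra.nonneg_iff_eq_star_mul_self (a := A)).1 hA.nonneg
  exact this

lemma prodState_posSemidef (X : Fin n → Matrix α α ℂ) (hX : ∀ u, (X u).PosSemidef) :
    (prodState X).PosSemidef := by
  choose Y hY using fun u => exists_conjTranspose_mul_self (hX u)
  have : prodState X = (prodState Y).conjTranspose * prodState Y := by
    rw [prodState_conjTranspose, prodState_mul]
    congr 1
    funext u
    exact hY u
  rw [this]
  exact Matrix.posSemidef_conjTranspose_mul_self _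

lemma trace_mul_nonneg {m : Type*} [Fintype m] [DecidableEq m] {A B : Matrix m m ℂ}
    (hA : A.PosSemidef) (hB : B.PosSemidef) : 0 ≤ (A * B).trace := by
  obtain ⟨Y, rfl⟩ := exists_conjTranspose_mul_self hB
  rw [← Matrix.mul_assoc, Matrix.trace_mul_comm, ← Matrix.mul_assoc]
  exact (hA.mul_mul_conjTranspose_same Y).trace_nonneg

lemma prodState_isDensity (σ : Fin n → Matrix α α ℂ) (h : ∀ u, IsDensity (σ u)) :
    IsDensity (prodState σ) :=
  ⟨prodState_posSemidef σ fun u => (h u).1, by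
    rw [trace_prodState]; exact Finset.prod_eq_one fun u _ => (h u).2⟩

end Prod

section Entropy
variable {m : Type*} [Fintype m] [DecidableEq m]

/-- rank one projector on a column -/
def pj (U : Matrix m m ℂ) (i : m) : Matrix m m ℂ := Matrix.of fun x y => U x i * star (U y i)

lemma pj_posSemidef (U : Matrix m m ℂ) (i : m) : (pj U i).PosSemidef :=
  Matrix.posSemidef_vecMulVec_self_star (fun x => U x i)

lemma sum_smul_pj (U : Matrix m m ℂ) (c : m → ℂ) :
    ∑ i, c i • pj U i = U * Matrix.diagonal c * U.conjTranspose := by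
  ext x y
  simp only [pj, Matrix.sum_apply, Matrix.smul_apply, Matrix.of_apply,
    Matrix.mul_apply (N := U.conjTranspose),
    Matrix.conjTranspose_apply, Matrix.mul_diagonal, smul_eq_mul]
  exact Finset.sum_congr rfl fun i _ => by ring

lemma sum_pj (U : Matrix m m ℂ) (hU : U.conjTranspose * U = 1) : ∑ i, pj U i = 1 := by
  have := sum_smul_pj U (fun _ => 1)
  simp only [one_smul] at this
  rw [this]
  have h : U * U.conjTranspose = 1 := mul_eq_one_comm.mp hU
  simp [h]

lemma trace_mul_pj (U ρ : Matrix m m ℂ) (i : m) :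
    (ρ * pj U i).trace = (U.conjTranspose * ρ * U) i i := by
  simp only [Matrix.trace, Matrix.diag, Matrix.mul_apply, pj, Matrix.of_apply,
    Matrix.conjTranspose_apply, Finset.sum_mul]
  rw [Finset.sum_comm]
  exact Finset.sum_congr rfl fun i _ => Finset.sum_congr rfl fun j _ => by ring

lemma gibbs_ineq (P : m → m → ℝ) (hP : ∀ j k, 0 ≤ P j k) (hr : ∀ j, ∑ k, P j k = 1)
    (hc : ∀ k, ∑ j, P j k = 1) (a w : m → ℝ) (ha : ∀ k, 0 ≤ a k) (hw : ∀ j, 0 ≤ w j)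
    (hs : ∑ j, w j ≤ ∑ k, a k) (hz : ∀ j, w j = 0 → ∑ k, P j k * a k = 0) :
    -∑ k, a k * Real.log (a k) ≤ -∑ j, (∑ k, P j k * a k) * Real.log (w j) := by
  have key : ∀ j k, P j k * a k * Real.log (w j) - P j k * (a k * Real.log (a k))
      ≤ P j k * w j - P j k * a k := by
    intro j k
    rcases (ha k).eq_or_lt with h0 | h0
    · rw [← h0]; simpa using mul_nonneg (hP j k) (hw j)
    rcases (hw j).eq_or_lt with h1 | h1
    · have h2 := (Finset.sum_eq_zero_iff_of_nonneg
        (fun k _ => mul_nonneg (hP j k) (ha k))).1 (hz j h1.symm) k (Finset.mem_univ k)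
      have h3 : P j k = 0 := by
        rcases mul_eq_zero.1 h2 with h | h
        · exact h
        · exact absurd h h0.ne'
      simp [h3]
    · have h2 := Real.log_le_sub_one_of_pos (div_pos h1 h0)
      rw [Real.log_div h1.ne' h0.ne'] at h2
      have h3 : a k * (Real.log (w j) - Real.log (a k)) ≤ w j - a k := by
        calc _ ≤ a k * (w j / a k - 1) := mul_le_mul_of_nonneg_left h2 h0.le
          _ = _ := by field_simp
      nlinarith [mul_le_mul_of_nonneg_left h3 (hP j k)]
  have h := Finset.sum_le_sum fun j (_ : j ∈ Finset.univ) =>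
    Finset.sum_le_sum fun k (_ : k ∈ Finset.univ) => key j k
  simp only [Finset.sum_sub_distrib] at h
  have e1 : ∑ j, ∑ k, P j k * a k * Real.log (w j)
      = ∑ j, (∑ k, P j k * a k) * Real.log (w j) := by
    simp only [Finset.sum_mul]
  have e2 : ∑ j, ∑ k, P j k * (a k * Real.log (a k)) = ∑ k, a k * Real.log (a k) := by
    rw [Finset.sum_comm]
    exact Finset.sum_congr rfl fun k _ => by rw [← Finset.sum_mul, hc, one_mul]
  have e3 : ∑ j, ∑ k, P j k * w j = ∑ j, w j :=
    Finset.sum_congr rfl fun k _ => by rw [← Finset.sum_mul, hr, one_mul]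
  have e4 : ∑ j, ∑ k, P j k * a k = ∑ k, a k := by
    rw [Finset.sum_comm]
    exact Finset.sum_congr rfl fun k _ => by rw [← Finset.sum_mul, hc, one_mul]
  rw [e1, e2, e3, e4] at h
  linarith

lemma unitary_row (G : Matrix m m ℂ) (hG : G * G.conjTranspose = 1) (j : m) :
    ∑ k, ‖G j k‖ ^ 2 = 1 := by
  have := congrFun (congrFun hG j) j
  simp only [Matrix.mul_apply, Matrix.conjTranspose_apply, Matrix.one_apply_eq] at this
  have h2 : ((∑ k, ‖G j k‖ ^ 2 : ℝ) : ℂ) = 1 := by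
    rw [← this]; push_cast
    exact Finset.sum_congr rfl fun k _ => by
      rw [← Complex.mul_conj']; rfl
  exact_mod_cast h2

lemma unitary_col (G : Matrix m m ℂ) (hG : G.conjTranspose * G = 1) (k : m) :
    ∑ j, ‖G j k‖ ^ 2 = 1 := by
  have := unitary_row G.conjTranspose (by simpa using hG) k
  simpa [Matrix.conjTranspose_apply] using this

lemma diag_conj (G : Matrix m m ℂ) (a : m → ℝ) (j : m) :
    ((G * Matrix.diagonal (fun k => (a k : ℂ)) * G.conjTranspose) j j).re
      = ∑ k, ‖G j k‖ ^ 2 * a k := by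
  simp only [Matrix.mul_apply (N := G.conjTranspose), Matrix.mul_diagonal,
    Matrix.conjTranspose_apply]
  rw [Complex.re_sum]
  refine Finset.sum_congr rfl fun k _ => ?_
  have : G j k * (a k : ℂ) * star (G j k) = ((‖G j k‖ ^ 2 * a k : ℝ) : ℂ) := by
    push_cast
    rw [← Complex.mul_conj']
    simp only [starRingEnd_apply]; ring
  rw [this, Complex.ofReal_re]

lemma spectral' {ρ : Matrix m m ℂ} (h : ρ.IsHermitian) :
    ∃ V : Matrix m m ℂ, V.conjTranspose * V = 1 ∧
      ρ = V * Matrix.diagonal (fun k => (h.eigenvalues k : ℂ)) * V.conjTranspose := by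
  refine ⟨h.eigenvectorUnitary, ?_, ?_⟩
  · exact Unitary.coe_star_mul_self h.eigenvectorUnitary
  · have := h.spectral_theorem
    rw [Unitary.conjStarAlgAut_apply] at this
    exact this

lemma sum_eigenvalues {ρ : Matrix m m ℂ} (h : IsDensity ρ) : ∑ k, h.1.1.eigenvalues k = 1 := by
  have h2 := h.2.symm.trans h.1.1.trace_eq_sum_eigenvalues
  have h3 := congrArg Complex.re h2
  simpa using h3.symm

lemma entropy_le {ρ : Matrix m m ℂ} (hρ : IsDensity ρ) (W : Matrix m m ℂ)
    (hW : W.conjTranspose * W = 1) (w : m → ℝ) (hw : ∀ j, 0 ≤ w j) (hs : ∑ j, w j ≤ 1)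
    (hz : ∀ j, w j = 0 → ((ρ * pj W j).trace).re = 0) :
    entropy ρ ≤ -∑ j, ((ρ * pj W j).trace).re * Real.log (w j) := by
  have hh := hρ.1.1
  obtain ⟨V, hV, hVρ⟩ := spectral' hh
  have hV' : V * V.conjTranspose = 1 := mul_eq_one_comm.mp hV
  have hW' : W * W.conjTranspose = 1 := mul_eq_one_comm.mp hW
  set G := W.conjTranspose * V with hG
  have hGG : G * G.conjTranspose = 1 := by
    rw [hG, Matrix.conjTranspose_mul, Matrix.conjTranspose_conjTranspose]
    calc _ = W.conjTranspose * (V * V.conjTranspose) * W := by simp only [Matrix.mul_assoc]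
      _ = 1 := by rw [hV', Matrix.mul_one, hW]
  have hq : ∀ j, ((ρ * pj W j).trace).re = ∑ k, ‖G j k‖ ^ 2 * hh.eigenvalues k := by
    intro j
    rw [trace_mul_pj, ← diag_conj]
    congr 2
    conv_lhs => rw [hVρ]
    rw [hG, Matrix.conjTranspose_mul, Matrix.conjTranspose_conjTranspose]
    simp only [Matrix.mul_assoc]
  have := gibbs_ineq (fun j k => ‖G j k‖ ^ 2) (fun _ _ => by positivity) (unitary_row G hGG)
    (unitary_col G (mul_eq_one_comm.mp hGG)) hh.eigenvalues w hρ.1.eigenvalues_nonneg hw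
    (by rw [sum_eigenvalues hρ]; exact hs) (fun j hj => by rw [← hq]; exact hz j hj)
  simp only [hq]
  rw [entropy, dif_pos hh]
  exact this

lemma entropy_ge {ρ : Matrix m m ℂ} (hρ : IsDensity ρ) (W : Matrix m m ℂ)
    (hW : W.conjTranspose * W = 1) (w : m → ℝ) (hw : ∀ j, 0 ≤ w j)
    (h : ρ = W * Matrix.diagonal (fun k => (w k : ℂ)) * W.conjTranspose) :
    -∑ j, w j * Real.log (w j) ≤ entropy ρ := by
  have hh := hρ.1.1
  obtain ⟨V, hV, hVρ⟩ := spectral' hh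
  have hV' : V * V.conjTranspose = 1 := mul_eq_one_comm.mp hV
  have hW' : W * W.conjTranspose = 1 := mul_eq_one_comm.mp hW
  set G := V.conjTranspose * W with hG
  have hGG : G * G.conjTranspose = 1 := by
    rw [hG, Matrix.conjTranspose_mul, Matrix.conjTranspose_conjTranspose]
    calc _ = V.conjTranspose * (W * W.conjTranspose) * V := by simp only [Matrix.mul_assoc]
      _ = 1 := by rw [hW', Matrix.mul_one, hV]
  have hq : ∀ j, hh.eigenvalues j = ∑ k, ‖G j k‖ ^ 2 * w k := by
    intro j
    rw [← diag_conj]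
    have : G * Matrix.diagonal (fun k => (w k : ℂ)) * G.conjTranspose
        = Matrix.diagonal (fun k => (hh.eigenvalues k : ℂ)) := by
      rw [hG, Matrix.conjTranspose_mul, Matrix.conjTranspose_conjTranspose]
      calc _ = V.conjTranspose * (W * Matrix.diagonal (fun k => (w k : ℂ)) * W.conjTranspose) * V := by
            simp only [Matrix.mul_assoc]
        _ = V.conjTranspose * ρ * V := by rw [← h]
        _ = V.conjTranspose * (V * Matrix.diagonal (fun k => (hh.eigenvalues k : ℂ))
              * V.conjTranspose) * V := by rw [← hVρ]
        _ = (V.conjTranspose * V) * Matrix.diagonal (fun k => (hh.eigenvalues k : ℂ))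
              * (V.conjTranspose * V) := by simp only [Matrix.mul_assoc]
        _ = _ := by rw [hV]; simp
    rw [this]; simp
  have hsum : ∑ j, hh.eigenvalues j = ∑ k, w k := by
    simp only [hq]
    rw [Finset.sum_comm]
    exact Finset.sum_congr rfl fun k _ => by
      rw [← Finset.sum_mul, unitary_col G (mul_eq_one_comm.mp hGG), one_mul]
  have := gibbs_ineq (fun j k => ‖G j k‖ ^ 2) (fun _ _ => by positivity) (unitary_row G hGG)
    (unitary_col G (mul_eq_one_comm.mp hGG)) w hh.eigenvalues hw hρ.1.eigenvalues_nonneg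
    hsum.le (fun j hj => by rw [← hq]; exact hj)
  simp only [← hq] at this
  rw [entropy, dif_pos hh]
  exact this

lemma prod_pj {n : ℕ} (V : Fin n → Matrix m m ℂ) (W : Matrix (Fin n → m) (Fin n → m) ℂ)
    (j : Fin n → m) (h : ∀ x, W x j = ∏ u, V u (x u) (j u)) :
    pj W j = prodState (fun u => pj (V u) (j u)) := by
  ext x y
  simp [pj, prodState, h, Finset.prod_mul_distrib]

lemma entropy_prodState_ge {n : ℕ} (σ : Fin n → Matrix m m ℂ) (hσ : ∀ u, IsDensity (σ u)) :
    ∑ u, entropy (σ u) ≤ entropy (prodState σ) := by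
  choose V hV hVσ using fun u => spectral' (hσ u).1.1
  set lam : Fin n → m → ℝ := fun u => (hσ u).1.1.eigenvalues with hlam
  have hlam0 : ∀ u i, 0 ≤ lam u i := fun u i => (hσ u).1.eigenvalues_nonneg i
  have hlam1 : ∀ u, ∑ i, lam u i = 1 := fun u => sum_eigenvalues (hσ u)
  have key := entropy_ge (prodState_isDensity σ hσ) (prodState V)
    (by rw [prodState_conjTranspose, prodState_mul]; simp only [hV]; exact prodState_one)
    (fun j => ∏ u, lam u (j u)) (fun j => Finset.prod_nonneg fun u _ => hlam0 u _) (by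
      have e : Matrix.diagonal (fun k : Fin n → m => ((∏ u, lam u (k u) : ℝ) : ℂ))
          = prodState (fun u => Matrix.diagonal (fun i => (lam u i : ℂ))) := by
        ext x y
        simp only [prodState, Matrix.diagonal_apply]
        by_cases h : x = y
        · subst h; simp
        · rw [if_neg h]
          obtain ⟨u, hu⟩ := Function.ne_iff.mp h
          exact (Finset.prod_eq_zero (Finset.mem_univ u) (by simp [hu])).symm
      rw [e, prodState_conjTranspose, prodState_mul, prodState_mul]
      congr 1
      funext u
      exact hVσ u)
  refine le_trans (le_of_eq ?_) key
  have h1 : ∀ j : Fin n → m, (∏ u, lam u (j u)) * Real.log (∏ u, lam u (j u))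
      = ∑ v, ∏ u, (if u = v then lam u (j u) * Real.log (lam u (j u)) else lam u (j u)) := by
    intro j
    have h3 : ∀ v, ∏ u, (if u = v then lam u (j u) * Real.log (lam u (j u)) else lam u (j u))
        = (∏ u, lam u (j u)) * Real.log (lam v (j v)) := by
      intro v
      have : ∀ u, (if u = v then lam u (j u) * Real.log (lam u (j u)) else lam u (j u))
          = lam u (j u) * (if u = v then Real.log (lam u (j u)) else 1) := by
        intro u; split_ifs <;> simp
      simp only [this, Finset.prod_mul_distrib]
      simp
    simp only [h3]
    rw [← Finset.mul_sum]
    by_cases h0 : ∃ u, lam u (j u) = 0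
    · obtain ⟨u, hu⟩ := h0
      rw [Finset.prod_eq_zero (Finset.mem_univ u) hu]; simp
    · push Not at h0
      rw [Real.log_prod (fun u _ => h0 u)]
  simp only [h1]
  rw [Finset.sum_comm, ← Finset.sum_neg_distrib]
  refine Finset.sum_congr rfl fun v _ => ?_
  rw [entropy, dif_pos (hσ v).1.1]
  congr 1
  have h2 := (Finset.prod_univ_sum (fun _ : Fin n => (Finset.univ : Finset m))
    (fun u i => if u = v then lam u i * Real.log (lam u i) else lam u i))
  rw [Fintype.piFinset_univ] at h2
  rw [← h2]
  rw [Finset.prod_eq_single v]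
  · simp [hlam]
  · intro u _ hu; simp [hu, hlam1]
  · simp

end Entropy

set_option linter.unusedSectionVars false

section Cond
variable {n : ℕ} {α : Type*} [Fintype α] [DecidableEq α]

/-- expectation of a product observable -/
def TT (ρ : Matrix (Fin n → α) (Fin n → α) ℂ) (X : Fin n → Matrix α α ℂ) : ℂ :=
  (ρ * prodState X).trace

def tau (ρ : Matrix (Fin n → α) (Fin n → α) ℂ) (X : Fin n → Matrix α α ℂ) : ℝ := (TT ρ X).re

def RR (ρ : Matrix (Fin n → α) (Fin n → α) ℂ) (X : Fin n → Matrix α α ℂ) (v : Fin n) :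
    Matrix α α ℂ :=
  Matrix.of fun i j => TT ρ (Function.update X v (Matrix.single j i 1))

def mm (α : Type*) [Fintype α] [DecidableEq α] : Matrix α α ℂ :=
  ((Fintype.card α : ℂ)⁻¹) • (1 : Matrix α α ℂ)

def rr (ρ : Matrix (Fin n → α) (Fin n → α) ℂ) (X : Fin n → Matrix α α ℂ) (v : Fin n) :
    Matrix α α ℂ :=
  if tau ρ X = 0 then mm α else ((tau ρ X : ℂ)⁻¹) • RR ρ X v

variable {ρ : Matrix (Fin n → α) (Fin n → α) ℂ}

lemma TT_nonneg (hρ : IsDensity ρ) {X : Fin n → Matrix α α ℂ} (hX : ∀ u, (X u).PosSemidef) :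
    0 ≤ TT ρ X := trace_mul_nonneg hρ.1 (prodState_posSemidef X hX)

lemma tau_nonneg (hρ : IsDensity ρ) {X : Fin n → Matrix α α ℂ} (hX : ∀ u, (X u).PosSemidef) :
    0 ≤ tau ρ X := (Complex.nonneg_iff.1 (TT_nonneg hρ hX)).1

lemma tau_cast (hρ : IsDensity ρ) {X : Fin n → Matrix α α ℂ} (hX : ∀ u, (X u).PosSemidef) :
    (tau ρ X : ℂ) = TT ρ X := by
  have h := Complex.nonneg_iff.1 (TT_nonneg hρ hX)
  apply Complex.ext
  · simp [tau]
  · simpa using h.2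

lemma TT_update_sum {κ : Type*} (s : Finset κ) (c : κ → ℂ) (X : Fin n → Matrix α α ℂ)
    (v : Fin n) (Z : κ → Matrix α α ℂ) :
    TT ρ (Function.update X v (∑ i ∈ s, c i • Z i)) =
      ∑ i ∈ s, c i * TT ρ (Function.update X v (Z i)) := by
  simp only [TT, prodState_update_sum, Matrix.mul_sum, Matrix.trace_sum, Matrix.mul_smul,
    Matrix.trace_smul, smul_eq_mul]

lemma TT_update (X : Fin n → Matrix α α ℂ) (v : Fin n) (Z : Matrix α α ℂ) :
    TT ρ (Function.update X v Z) = (RR ρ X v * Z).trace := by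
  have hZ : Z = ∑ p : α × α, Z p.1 p.2 • Matrix.single p.1 p.2 (1 : ℂ) := by
    conv_lhs => rw [Matrix.matrix_eq_sum_single Z]
    rw [Fintype.sum_prod_type]
    refine Finset.sum_congr rfl fun i _ => Finset.sum_congr rfl fun j _ => ?_
    rw [Matrix.smul_single]; simp
  conv_lhs => rw [hZ]
  rw [TT_update_sum, Fintype.sum_prod_type]
  simp only [Matrix.trace, Matrix.diag, Matrix.mul_apply, RR, Matrix.of_apply]
  rw [Finset.sum_comm]
  exact Finset.sum_congr rfl fun i _ => Finset.sum_congr rfl fun j _ => by ring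

lemma TT_conj (hρ : IsDensity ρ) (X : Fin n → Matrix α α ℂ) :
    star (TT ρ X) = TT ρ (fun u => (X u).conjTranspose) := by
  rw [TT, ← Matrix.trace_conjTranspose, Matrix.conjTranspose_mul, hρ.1.1.eq,
    Matrix.trace_mul_comm, prodState_conjTranspose, TT]

lemma RR_posSemidef (hρ : IsDensity ρ) {X : Fin n → Matrix α α ℂ} (hX : ∀ u, (X u).PosSemidef)
    (v : Fin n) : (RR ρ X v).PosSemidef := by
  apply Matrix.PosSemidef.of_dotProduct_mulVec_nonneg
  · ext i j
    rw [Matrix.conjTranspose_apply, RR, Matrix.of_apply, Matrix.of_apply, TT_conj hρ]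
    congr 1
    funext u
    by_cases h : u = v
    · subst h; simp [Matrix.conjTranspose_single]
    · simp [Function.update_of_ne h, (hX u).1.eq]
  · intro x
    have h : star x ⬝ᵥ Matrix.mulVec (RR ρ X v) x
        = TT ρ (Function.update X v (Matrix.vecMulVec x (star x))) := by
      rw [TT_update]
      simp only [Matrix.trace, Matrix.diag, Matrix.mul_apply, Matrix.vecMulVec_apply,
        dotProduct, Matrix.mulVec, Finset.mul_sum]
      exact Finset.sum_congr rfl fun i _ => Finset.sum_congr rfl fun j _ => by ring
    rw [h]
    apply TT_nonneg hρ
    intro u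
    by_cases h : u = v
    · subst h; simpa using Matrix.posSemidef_vecMulVec_self_star x
    · simpa [Function.update_of_ne h] using hX u

lemma RR_trace (X : Fin n → Matrix α α ℂ) (v : Fin n) (hv : X v = 1) :
    (RR ρ X v).trace = TT ρ X := by
  have h := TT_update (ρ := ρ) X v 1
  rw [← hv, Function.update_eq_self, hv, Matrix.mul_one] at h
  exact h.symm

lemma mm_density [Nonempty α] : IsDensity (mm α) := by
  constructor
  · apply Matrix.PosSemidef.smul Matrix.PosSemidef.one
    rw [inv_nonneg]; exact_mod_cast Nat.zero_le _
  · rw [mm, Matrix.trace_smul, Matrix.trace_one]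
    have : (Fintype.card α : ℂ) ≠ 0 := by exact_mod_cast Fintype.card_ne_zero
    simp [this]

lemma rr_density [Nonempty α] (hρ : IsDensity ρ) {X : Fin n → Matrix α α ℂ}
    (hX : ∀ u, (X u).PosSemidef) (v : Fin n) (hv : X v = 1) : IsDensity (rr ρ X v) := by
  rw [rr]
  split_ifs with h
  · exact mm_density
  · constructor
    · apply (RR_posSemidef hρ hX v).smul
      rw [inv_nonneg]; exact_mod_cast tau_nonneg hρ hX
    · rw [Matrix.trace_smul, RR_trace X v hv, ← tau_cast hρ hX, smul_eq_mul]
      exact inv_mul_cancel₀ (by exact_mod_cast h)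

lemma tau_smul_rr (hρ : IsDensity ρ) {X : Fin n → Matrix α α ℂ}
    (hX : ∀ u, (X u).PosSemidef) (v : Fin n) (hv : X v = 1) :
    (tau ρ X : ℂ) • rr ρ X v = RR ρ X v := by
  rw [rr]
  split_ifs with h
  · have h1 : (RR ρ X v).trace = 0 := by rw [RR_trace X v hv, ← tau_cast hρ hX, h]; simp
    rw [(RR_posSemidef hρ hX v).trace_eq_zero_iff.1 h1, h]; simp
  · rw [smul_smul, mul_inv_cancel₀ (by exact_mod_cast h), one_smul]

lemma density_entry_le {Z : Matrix α α ℂ} (hZ : IsDensity Z) (i j : α) : ‖Z i j‖ ≤ 1 := by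
  obtain ⟨Y, hY⟩ := exists_conjTranspose_mul_self hZ.1
  have hd : ∀ i, ∑ k, ‖Y k i‖ ^ 2 ≤ 1 := by
    have h1 : ∑ i, ∑ k, ‖Y k i‖ ^ 2 = 1 := by
      have h := hZ.2
      rw [hY] at h
      simp only [Matrix.trace, Matrix.diag, Matrix.mul_apply, Matrix.conjTranspose_apply] at h
      have h2 : ((∑ i, ∑ k, ‖Y k i‖ ^ 2 : ℝ) : ℂ) = 1 := by
        rw [← h]; push_cast
        refine Finset.sum_congr rfl fun i _ => Finset.sum_congr rfl fun k _ => ?_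
        rw [← Complex.conj_mul']; rfl
      exact_mod_cast h2
    intro i
    rw [← h1]
    exact Finset.single_le_sum (f := fun i => ∑ k, ‖Y k i‖ ^ 2)
      (fun _ _ => Finset.sum_nonneg fun _ _ => by positivity) (Finset.mem_univ i)
  rw [hY, Matrix.mul_apply]
  calc _ ≤ ∑ k, ‖Y k i‖ * ‖Y k j‖ := by
        refine (norm_sum_le _ _).trans (le_of_eq ?_)
        simp [Matrix.conjTranspose_apply]
    _ ≤ ∑ k, (‖Y k i‖ ^ 2 + ‖Y k j‖ ^ 2) / 2 :=
        Finset.sum_le_sum fun k _ => by nlinarith [sq_nonneg (‖Y k i‖ - ‖Y k j‖)]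
    _ ≤ 1 := by
        rw [← Finset.sum_div, Finset.sum_add_distrib]
        linarith [hd i, hd j]

/-- squared Frobenius norm -/
def nsq (Z : Matrix α α ℂ) : ℝ := ∑ i, ∑ j, ‖Z i j‖ ^ 2

lemma nsq_nonneg (Z : Matrix α α ℂ) : 0 ≤ nsq Z :=
  Finset.sum_nonneg fun _ _ => Finset.sum_nonneg fun _ _ => by positivity

lemma nsq_density {Z : Matrix α α ℂ} (hZ : IsDensity Z) : nsq Z ≤ (Fintype.card α : ℝ) ^ 2 := by
  calc nsq Z ≤ ∑ _i : α, ∑ _j : α, (1 : ℝ) :=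
        Finset.sum_le_sum fun i _ => Finset.sum_le_sum fun j _ =>
          pow_le_one₀ (norm_nonneg _) (density_entry_le hZ i j)
    _ = _ := by simp [sq]

lemma sum_sq_dev {κ : Type*} [Fintype κ] (t : κ → ℝ) (z : κ → ℂ) (z0 : ℂ) (b : ℝ)
    (h1 : ∑ x, t x = b) (h2 : ∑ x, (t x : ℂ) * z x = b * z0) :
    ∑ x, t x * ‖z x - z0‖ ^ 2 = ∑ x, t x * ‖z x‖ ^ 2 - b * ‖z0‖ ^ 2 := by
  have e : ∀ x, t x * ‖z x - z0‖ ^ 2 = t x * ‖z x‖ ^ 2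
      - 2 * ((((t x : ℂ) * z x) * star z0).re) + t x * ‖z0‖ ^ 2 := by
    intro x
    simp only [← Complex.normSq_eq_norm_sq, Complex.normSq_apply, Complex.sub_re, Complex.sub_im,
      Complex.mul_re, Complex.mul_im, Complex.ofReal_re, Complex.ofReal_im,
      Complex.star_def, Complex.conj_re, Complex.conj_im]
    ring
  simp only [e]
  rw [Finset.sum_add_distrib, Finset.sum_sub_distrib, ← Finset.mul_sum, ← Complex.re_sum,
    ← Finset.sum_mul, h2, ← Finset.sum_mul, h1]
  have : ((b : ℂ) * z0 * star z0).re = b * ‖z0‖ ^ 2 := by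
    simp only [← Complex.normSq_eq_norm_sq, Complex.normSq_apply,
      Complex.mul_re, Complex.mul_im, Complex.ofReal_re, Complex.ofReal_im,
      Complex.star_def, Complex.conj_re, Complex.conj_im]
    ring
  rw [this]; ring

lemma sum_nsq_dev {κ : Type*} [Fintype κ] (t : κ → ℝ) (z : κ → Matrix α α ℂ) (z0 : Matrix α α ℂ)
    (b : ℝ) (h1 : ∑ x, t x = b) (h2 : ∑ x, (t x : ℂ) • z x = (b : ℂ) • z0) :
    ∑ x, t x * nsq (z x - z0) = ∑ x, t x * nsq (z x) - b * nsq z0 := by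
  have e : ∀ i j, ∑ x, t x * ‖z x i j - z0 i j‖ ^ 2
      = ∑ x, t x * ‖z x i j‖ ^ 2 - b * ‖z0 i j‖ ^ 2 := by
    intro i j
    apply sum_sq_dev _ _ _ _ h1
    have := congrFun (congrFun h2 i) j
    simpa [Matrix.sum_apply] using this
  have sw : ∀ f : κ → α → α → ℝ, ∑ x, t x * ∑ i, ∑ j, f x i j = ∑ i, ∑ j, ∑ x, t x * f x i j := by
    intro f
    simp only [Finset.mul_sum]
    rw [Finset.sum_comm]
    exact Finset.sum_congr rfl fun i _ => Finset.sum_comm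
  simp only [nsq, sw, Matrix.sub_apply, e, Finset.sum_sub_distrib]
  simp only [Finset.mul_sum]

end Cond

set_option linter.unusedSectionVars false

section Meas
variable {n : ℕ} {α : Type*} [Fintype α] [DecidableEq α] {B : Type*} [Fintype B]

def QQ (U : B → Matrix α α ℂ) (x : B × α) : Matrix α α ℂ := pj (U x.1) x.2

/-- the tuple of effects: projectors on measured sites, identity elsewhere -/
def XA (U : B → Matrix α α ℂ) (A : Finset (Fin n)) (ω : Fin n → B × α) : Fin n → Matrix α α ℂ :=
  fun u => if u ∈ A then QQ U (ω u) else 1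

def wt (α B : Type*) [Fintype α] [Fintype B] (A : Finset (Fin n)) : ℝ :=
  ∏ u : Fin n, if u ∈ A then ((Fintype.card B : ℝ))⁻¹ else ((Fintype.card (B × α) : ℝ))⁻¹

def NN (A : Finset (Fin n)) (G : (Fin n → B × α) → ℝ) : ℝ := wt α B A * ∑ ω, G ω

lemma wt_nonneg (A : Finset (Fin n)) : 0 ≤ wt α B A :=
  Finset.prod_nonneg fun u _ => by split_ifs <;> positivity

lemma NN_mono (A : Finset (Fin n)) {G G' : (Fin n → B × α) → ℝ} (h : ∀ ω, G ω ≤ G' ω) :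
    NN A G ≤ NN A G' :=
  mul_le_mul_of_nonneg_left (Finset.sum_le_sum fun ω _ => h ω) (wt_nonneg A)

lemma NN_nonneg (A : Finset (Fin n)) {G : (Fin n → B × α) → ℝ} (h : ∀ ω, 0 ≤ G ω) :
    0 ≤ NN A G :=
  mul_nonneg (wt_nonneg A) (Finset.sum_nonneg fun ω _ => h ω)

lemma NN_add (A : Finset (Fin n)) (G G' : (Fin n → B × α) → ℝ) :
    NN A (fun ω => G ω + G' ω) = NN A G + NN A G' := by
  simp only [NN, Finset.sum_add_distrib, mul_add]

lemma NN_sub (A : Finset (Fin n)) (G G' : (Fin n → B × α) → ℝ) :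
    NN A (fun ω => G ω - G' ω) = NN A G - NN A G' := by
  simp only [NN, Finset.sum_sub_distrib, mul_sub]

lemma NN_mul (A : Finset (Fin n)) (c : ℝ) (G : (Fin n → B × α) → ℝ) :
    NN A (fun ω => c * G ω) = c * NN A G := by
  simp only [NN, ← Finset.mul_sum]; ring

lemma NN_sum {κ : Type*} (s : Finset κ) (A : Finset (Fin n)) (G : κ → (Fin n → B × α) → ℝ) :
    NN A (fun ω => ∑ e ∈ s, G e ω) = ∑ e ∈ s, NN A (G e) := by
  simp only [NN]
  rw [Finset.sum_comm, Finset.mul_sum]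

variable {U : B → Matrix α α ℂ}

lemma QQ_psd (x : B × α) : (QQ U x).PosSemidef := pj_posSemidef _ _

lemma XA_psd (A : Finset (Fin n)) (ω : Fin n → B × α) (u : Fin n) : (XA U A ω u).PosSemidef := by
  rw [XA]; split_ifs
  · exact QQ_psd _
  · exact Matrix.PosSemidef.one

lemma sum_QQ (hU : ∀ b, (U b).conjTranspose * U b = 1) :
    ∑ x, QQ U x = (Fintype.card B : ℂ) • (1 : Matrix α α ℂ) := by
  rw [Fintype.sum_prod_type]
  simp only [QQ, sum_pj _ (hU _)]
  simp [Nat.cast_smul_eq_nsmul]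

variable [Nonempty α] [Nonempty B]

lemma NN_TT (hU : ∀ b, (U b).conjTranspose * U b = 1)
    (ρ : Matrix (Fin n → α) (Fin n → α) ℂ) (A : Finset (Fin n)) (Y : Fin n → Matrix α α ℂ) :
    (wt α B A : ℂ) * ∑ ω : Fin n → B × α, TT ρ (fun u => if u ∈ A then QQ U (ω u) else Y u)
      = TT ρ (fun u => if u ∈ A then 1 else Y u) := by
  simp only [TT]
  rw [← Matrix.trace_sum, ← Matrix.mul_sum,
    sum_prodState (fun u x => if u ∈ A then QQ U x else Y u), ← smul_eq_mul,
    ← Matrix.trace_smul, ← Matrix.mul_smul, wt]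
  push_cast
  rw [smul_prodState]
  congr 3
  funext u
  have hB : (Fintype.card B : ℂ) ≠ 0 := by exact_mod_cast Fintype.card_ne_zero
  have hα : (Fintype.card α : ℂ) ≠ 0 := by exact_mod_cast Fintype.card_ne_zero
  by_cases h : u ∈ A
  · simp only [h, if_true, sum_QQ hU]
    rw [smul_smul]
    push_cast
    rw [inv_mul_cancel₀ hB, one_smul]
  · simp only [h, if_false, Finset.sum_const, Finset.card_univ]
    rw [← Nat.cast_smul_eq_nsmul ℂ, smul_smul]
    push_cast [Fintype.card_prod]
    rw [inv_mul_cancel₀ (mul_ne_zero hB hα), one_smul]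

lemma TT_one {ρ : Matrix (Fin n → α) (Fin n → α) ℂ} (hρ : IsDensity ρ) :
    TT ρ (fun _ => 1) = 1 := by
  rw [TT, prodState_one, Matrix.mul_one, hρ.2]

lemma NN_tau (hU : ∀ b, (U b).conjTranspose * U b = 1)
    {ρ : Matrix (Fin n → α) (Fin n → α) ℂ} (hρ : IsDensity ρ) (A : Finset (Fin n)) :
    NN A (fun ω => tau ρ (XA U A ω)) = 1 := by
  have h := NN_TT hU ρ A (fun _ => 1)
  simp only [ite_self, TT_one hρ] at h
  have h2 := congrArg Complex.re h
  rw [Complex.re_ofReal_mul, Complex.re_sum] at h2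
  exact h2

lemma sum_update {κ : Type*} [Fintype κ] (u : Fin n) (G : (Fin n → κ) → ℝ) :
    ∑ ω, ∑ x, G (Function.update ω u x) = (Fintype.card κ : ℝ) * ∑ ω, G ω := by
  classical
  let e : (Fin n → κ) × κ ≃ (Fin n → κ) × κ :=
    { toFun := fun p => (Function.update p.1 u p.2, p.1 u)
      invFun := fun p => (Function.update p.1 u p.2, p.1 u)
      left_inv := fun p => by simp
      right_inv := fun p => by simp }
  have h := Equiv.sum_comp e (fun p => G p.1)
  simp only [e, Equiv.coe_fn_mk] at h
  rw [Fintype.sum_prod_type, Fintype.sum_prod_type] at h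
  rw [h]
  simp [Finset.mul_sum]

lemma NN_insert (A : Finset (Fin n)) (u : Fin n) (hu : u ∉ A) (G : (Fin n → B × α) → ℝ) :
    NN (insert u A) G
      = NN A (fun ω => (Fintype.card B : ℝ)⁻¹ * ∑ x, G (Function.update ω u x)) := by
  classical
  simp only [NN]
  rw [← Finset.mul_sum, sum_update]
  have hB : (Fintype.card B : ℝ) ≠ 0 := by exact_mod_cast Fintype.card_ne_zero
  have hα : (Fintype.card α : ℝ) ≠ 0 := by exact_mod_cast Fintype.card_ne_zero
  have h : wt α B (insert u A) = wt α B A * ((Fintype.card B : ℝ)⁻¹ * Fintype.card (B × α)) := by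
    rw [wt, wt, ← Finset.mul_prod_erase Finset.univ _ (Finset.mem_univ u),
      ← Finset.mul_prod_erase Finset.univ _ (Finset.mem_univ u)]
    have : ∏ x ∈ Finset.univ.erase u, (if x ∈ insert u A then (Fintype.card B : ℝ)⁻¹
          else (Fintype.card (B × α) : ℝ)⁻¹)
        = ∏ x ∈ Finset.univ.erase u, (if x ∈ A then (Fintype.card B : ℝ)⁻¹
          else (Fintype.card (B × α) : ℝ)⁻¹) := by
      apply Finset.prod_congr rfl
      intro x hx
      simp [Finset.mem_insert, Finset.ne_of_mem_erase hx]
    rw [this]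
    simp only [Finset.mem_insert_self, if_true, hu, if_false, Fintype.card_prod]
    push_cast
    field_simp
  rw [h]; ring

lemma XA_update_notMem (A : Finset (Fin n)) (u : Fin n) (hu : u ∉ A) (ω : Fin n → B × α)
    (x : B × α) : XA U A (Function.update ω u x) = XA U A ω := by
  funext v
  simp only [XA]
  split_ifs with h
  · rw [Function.update_of_ne (by rintro rfl; exact hu h)]
  · rfl

lemma XA_insert_update (A : Finset (Fin n)) (u : Fin n) (ω : Fin n → B × α)
    (x : B × α) : XA U (insert u A) (Function.update ω u x)
      = Function.update (XA U A ω) u (QQ U x) := by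
  funext v
  by_cases h : v = u
  · subst h; simp [XA]
  · simp [XA, h]

/-- the product state associated to outcomes -/
def sg (ρ : Matrix (Fin n → α) (Fin n → α) ℂ) (U : B → Matrix α α ℂ) (A : Finset (Fin n))
    (ω : Fin n → B × α) : Fin n → Matrix α α ℂ :=
  fun u => if u ∈ A then mm α else rr ρ (XA U A ω) u

variable {ρ : Matrix (Fin n → α) (Fin n → α) ℂ}

lemma sg_density (hρ : IsDensity ρ) (A : Finset (Fin n)) (ω : Fin n → B × α) (u : Fin n) :
    IsDensity (sg ρ U A ω u) := by
  rw [sg]; split_ifs with h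
  · exact mm_density
  · exact rr_density hρ (XA_psd A ω) u (by simp [XA, h])

/-- summed squared influence of measuring `u` on site `v` -/
def DD (ρ : Matrix (Fin n → α) (Fin n → α) ℂ) (U : B → Matrix α α ℂ) (u v : Fin n)
    (A : Finset (Fin n)) : ℝ :=
  NN A (fun ω => (Fintype.card B : ℝ)⁻¹ * ∑ x,
    tau ρ (Function.update (XA U A ω) u (QQ U x)) *
      nsq (rr ρ (Function.update (XA U A ω) u (QQ U x)) v - rr ρ (XA U A ω) v))

def phi (ρ : Matrix (Fin n → α) (Fin n → α) ℂ) (U : B → Matrix α α ℂ) (v : Fin n)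
    (A : Finset (Fin n)) : ℝ :=
  if v ∈ A then (Fintype.card α : ℝ) ^ 2
  else NN A (fun ω => tau ρ (XA U A ω) * nsq (rr ρ (XA U A ω) v))

lemma upd_psd (X : Fin n → Matrix α α ℂ) (hX : ∀ u, (X u).PosSemidef) (u : Fin n) (x : B × α)
    (v : Fin n) : (Function.update X u (QQ U x) v).PosSemidef := by
  by_cases h : v = u
  · subst h; simpa using QQ_psd x
  · simpa [h] using hX v

lemma DD_nonneg (hρ : IsDensity ρ) (u v : Fin n) (A : Finset (Fin n)) : 0 ≤ DD ρ U u v A := by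
  apply NN_nonneg
  intro ω
  apply mul_nonneg (by positivity)
  exact Finset.sum_nonneg fun x _ => mul_nonneg (tau_nonneg hρ (upd_psd _ (XA_psd A ω) u x))
    (nsq_nonneg _)

lemma sum_TT_upd (hU : ∀ b, (U b).conjTranspose * U b = 1) (X : Fin n → Matrix α α ℂ) (u : Fin n)
    (hu : X u = 1) : ∑ x, TT ρ (Function.update X u (QQ U x)) = (Fintype.card B : ℂ) * TT ρ X := by
  have h1 := TT_update_sum (ρ := ρ) Finset.univ (fun _ : B × α => (1 : ℂ)) X u (QQ U)
  simp only [one_smul, one_mul] at h1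
  rw [← h1, sum_QQ hU]
  have h2 := TT_update_sum (ρ := ρ) {()} (fun _ : Unit => (Fintype.card B : ℂ)) X u (fun _ => 1)
  simp only [Finset.sum_singleton] at h2
  rw [h2, ← hu, Function.update_eq_self]

lemma sum_tau_upd (hU : ∀ b, (U b).conjTranspose * U b = 1) (X : Fin n → Matrix α α ℂ) (u : Fin n)
    (hu : X u = 1) :
    ∑ x, tau ρ (Function.update X u (QQ U x)) = (Fintype.card B : ℝ) * tau ρ X := by
  have := congrArg Complex.re (sum_TT_upd (ρ := ρ) hU X u hu)
  rw [Complex.re_sum] at this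
  simp only [tau, this]
  exact Complex.re_ofReal_mul (Fintype.card B : ℝ) _

lemma sum_RR_upd (hU : ∀ b, (U b).conjTranspose * U b = 1) (X : Fin n → Matrix α α ℂ) (u v : Fin n)
    (hu : X u = 1) (huv : u ≠ v) :
    ∑ x, RR ρ (Function.update X u (QQ U x)) v = (Fintype.card B : ℂ) • RR ρ X v := by
  ext i j
  simp only [Matrix.sum_apply, Matrix.smul_apply, RR, Matrix.of_apply, smul_eq_mul]
  rw [← sum_TT_upd hU _ u (by rw [Function.update_of_ne huv, hu])]
  exact Finset.sum_congr rfl fun x _ => by rw [Function.update_comm huv]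

lemma phi_insert (hU : ∀ b, (U b).conjTranspose * U b = 1) (hρ : IsDensity ρ) (u v : Fin n)
    (A : Finset (Fin n)) (hu : u ∉ A) (hv : v ∉ A) (huv : u ≠ v) :
    phi ρ U v (insert u A) = phi ρ U v A + DD ρ U u v A := by
  have hv' : v ∉ insert u A := by simp [hv, huv.symm]
  rw [phi, phi, if_neg hv', if_neg hv, NN_insert A u hu, DD, ← NN_add]
  congr 1
  funext ω
  simp only [XA_insert_update]
  have hB : (Fintype.card B : ℝ) ≠ 0 := by exact_mod_cast Fintype.card_ne_zero
  have hXu : XA U A ω u = 1 := by simp [XA, hu]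
  have hXv : XA U A ω v = 1 := by simp [XA, hv]
  have h := sum_nsq_dev (fun x => tau ρ (Function.update (XA U A ω) u (QQ U x)))
    (fun x => rr ρ (Function.update (XA U A ω) u (QQ U x)) v) (rr ρ (XA U A ω) v)
    ((Fintype.card B : ℝ) * tau ρ (XA U A ω)) (sum_tau_upd hU _ u hXu) (by
      have : ∀ x, ((tau ρ (Function.update (XA U A ω) u (QQ U x)) : ℝ) : ℂ) •
          rr ρ (Function.update (XA U A ω) u (QQ U x)) v
          = RR ρ (Function.update (XA U A ω) u (QQ U x)) v := fun x =>
        tau_smul_rr hρ (upd_psd _ (XA_psd A ω) u x) v (by rw [Function.update_of_ne huv.symm, hXv])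
      simp only [this]
      rw [sum_RR_upd hU _ u v hXu huv]
      push_cast
      rw [mul_smul, tau_smul_rr hρ (XA_psd A ω) v hXv])
  rw [h]
  field_simp
  ring

lemma phi_nonneg (hρ : IsDensity ρ) (v : Fin n) (A : Finset (Fin n)) : 0 ≤ phi ρ U v A := by
  rw [phi]; split_ifs
  · positivity
  · exact NN_nonneg A fun ω => mul_nonneg (tau_nonneg hρ (XA_psd A ω)) (nsq_nonneg _)

lemma phi_le (hU : ∀ b, (U b).conjTranspose * U b = 1) (hρ : IsDensity ρ) (v : Fin n)
    (A : Finset (Fin n)) : phi ρ U v A ≤ (Fintype.card α : ℝ) ^ 2 := by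
  rw [phi]; split_ifs with h
  · exact le_rfl
  · calc _ ≤ NN A (fun ω => (Fintype.card α : ℝ) ^ 2 * tau ρ (XA U A ω)) := by
          apply NN_mono
          intro ω
          rw [mul_comm]
          exact mul_le_mul_of_nonneg_right (nsq_density
            (rr_density hρ (XA_psd A ω) v (by simp [XA, h]))) (tau_nonneg hρ (XA_psd A ω))
      _ = _ := by rw [NN_mul, NN_tau hU hρ, mul_one]

/-- indicator-like influence, zero when the pair is touched by `A` -/
def DA (ρ : Matrix (Fin n → α) (Fin n → α) ℂ) (U : B → Matrix α α ℂ) (u v : Fin n)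
    (A : Finset (Fin n)) : ℝ :=
  if u ∉ A ∧ v ∉ A ∧ u ≠ v then DD ρ U u v A else 0

lemma DA_nonneg (hρ : IsDensity ρ) (u v : Fin n) (A : Finset (Fin n)) : 0 ≤ DA ρ U u v A := by
  rw [DA]; split_ifs
  · exact DD_nonneg hρ u v A
  · exact le_rfl

lemma phi_step (hU : ∀ b, (U b).conjTranspose * U b = 1) (hρ : IsDensity ρ) (u v : Fin n)
    (A : Finset (Fin n)) : phi ρ U v A + DA ρ U u v A ≤ phi ρ U v (insert u A) := by
  by_cases hu : u ∈ A
  · simp [DA, hu]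
  by_cases hv : v ∈ A
  · simp [DA, hv, phi]
  by_cases huv : u = v
  · subst huv
    have := phi_le hU hρ u A
    have h2 : phi ρ U u (insert u A) = (Fintype.card α : ℝ) ^ 2 := by simp [phi]
    rw [h2]
    simpa [DA] using this
  · rw [phi_insert hU hρ u v A hu hv huv, DA, if_pos ⟨hu, hv, huv⟩]

/-- average over `t` uniformly random inserted sites -/
def ES : ℕ → (Finset (Fin n) → ℝ) → ℝ
  | 0, g => g ∅
  | t + 1, g => ES t (fun A => (n : ℝ)⁻¹ * ∑ u : Fin n, g (insert u A))

lemma ES_mono (t : ℕ) : ∀ {g g' : Finset (Fin n) → ℝ}, (∀ A, g A ≤ g' A) → ES t g ≤ ES t g' := by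
  induction t with
  | zero => intro g g' h; exact h ∅
  | succ t ih =>
    intro g g' h
    exact ih fun A => mul_le_mul_of_nonneg_left (Finset.sum_le_sum fun u _ => h _) (by positivity)

lemma ES_add (t : ℕ) : ∀ (g g' : Finset (Fin n) → ℝ),
    ES t (fun A => g A + g' A) = ES t g + ES t g' := by
  induction t with
  | zero => intro g g'; rfl
  | succ t ih =>
    intro g g'
    simp only [ES, ← ih, Finset.sum_add_distrib, mul_add]

lemma ES_mul (t : ℕ) : ∀ (c : ℝ) (g : Finset (Fin n) → ℝ),
    ES t (fun A => c * g A) = c * ES t g := by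
  induction t with
  | zero => intro c g; rfl
  | succ t ih =>
    intro c g
    simp only [ES, ← ih, ← Finset.mul_sum]
    congr 1
    funext A; ring

lemma ES_const (hn : 0 < n) (t : ℕ) (c : ℝ) : ES (n := n) t (fun _ => c) = c := by
  induction t with
  | zero => rfl
  | succ t ih =>
    simp only [ES]
    have : (n : ℝ) ≠ 0 := by positivity
    rw [← ih]
    congr 1
    funext A
    simp [this, ih]

lemma ES_sum {κ : Type*} (s : Finset κ) (t : ℕ) (g : κ → Finset (Fin n) → ℝ) :
    ES t (fun A => ∑ e ∈ s, g e A) = ∑ e ∈ s, ES t (g e) := by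
  classical
  induction s using Finset.induction_on with
  | empty =>
    have := ES_mul (n := n) t 0 (fun _ => 0)
    simpa using this
  | insert a s ha ih =>
    simp only [Finset.sum_insert ha, ES_add, ih]

lemma ES_mem (hn : 0 < n) (t : ℕ) (u : Fin n) :
    ES t (fun A => if u ∈ A then (1 : ℝ) else 0) ≤ t / n := by
  have hn' : (0 : ℝ) < n := by exact_mod_cast hn
  induction t with
  | zero => simp [ES]
  | succ t ih =>
    rw [ES]
    calc _ ≤ ES t (fun A => (if u ∈ A then (1 : ℝ) else 0) + (n : ℝ)⁻¹) := by
          apply ES_mono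
          intro A
          have : ∑ w : Fin n, (if u ∈ insert w A then (1 : ℝ) else 0)
              ≤ ∑ w : Fin n, ((if u ∈ A then (1 : ℝ) else 0) + if u = w then 1 else 0) := by
            apply Finset.sum_le_sum
            intro w _
            by_cases h1 : u = w
            · subst h1
              by_cases h2 : u ∈ A <;> simp [h2]
            · simp [h1]
          rw [Finset.sum_add_distrib] at this
          simp only [Finset.sum_const, Finset.card_univ, Fintype.card_fin, nsmul_eq_mul,
            Finset.sum_ite_eq, Finset.mem_univ, if_true] at this
          calc _ ≤ (n : ℝ)⁻¹ * (n * (if u ∈ A then 1 else 0) + 1) :=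
                mul_le_mul_of_nonneg_left this (by positivity)
            _ = _ := by field_simp
      _ ≤ t / n + (n : ℝ)⁻¹ := by
          rw [ES_add, ES_const hn]; linarith
      _ = _ := by push_cast; field_simp

lemma ES_phi (hU : ∀ b, (U b).conjTranspose * U b = 1) (hρ : IsDensity ρ) (hn : 0 < n) (l : ℕ) :
    ∑ t ∈ Finset.range l, ES t (fun A => ∑ u, ∑ v, DA ρ U u v A)
      ≤ (n : ℝ) ^ 2 * (Fintype.card α : ℝ) ^ 2 := by
  have hn' : (0 : ℝ) < n := by exact_mod_cast hn
  have key : ∀ l, ∑ t ∈ Finset.range l, ES t (fun A => ∑ u, ∑ v, DA ρ U u v A)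
      ≤ n * ES l (fun A => ∑ v, phi ρ U v A) := by
    intro l
    induction l with
    | zero => simpa [ES] using mul_nonneg hn'.le (Finset.sum_nonneg fun v _ => phi_nonneg hρ v ∅)
    | succ l ih =>
      rw [Finset.sum_range_succ]
      have h : ES l (fun A => ∑ v, phi ρ U v A + (n : ℝ)⁻¹ * ∑ u, ∑ v, DA ρ U u v A)
          ≤ ES (l + 1) (fun A => ∑ v, phi ρ U v A) := by
        rw [ES]
        apply ES_mono
        intro A
        have h1 := Finset.sum_le_sum fun u (_ : u ∈ Finset.univ) =>
          Finset.sum_le_sum fun v (_ : v ∈ Finset.univ) => phi_step hU hρ u v A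
        simp only [Finset.sum_add_distrib, Finset.sum_const, Finset.card_univ, Fintype.card_fin,
          nsmul_eq_mul] at h1
        calc _ = (n : ℝ)⁻¹ * (n * ∑ v, phi ρ U v A + ∑ u, ∑ v, DA ρ U u v A) := by field_simp
          _ ≤ _ := mul_le_mul_of_nonneg_left h1 (by positivity)
      rw [ES_add, ES_mul] at h
      have h2 := mul_le_mul_of_nonneg_left h hn'.le
      rw [mul_add, ← mul_assoc, mul_inv_cancel₀ hn'.ne', one_mul] at h2
      linarith
  refine (key l).trans ?_
  calc _ ≤ n * ES l (fun _ : Finset (Fin n) => (n : ℝ) * (Fintype.card α : ℝ) ^ 2) := by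
        apply mul_le_mul_of_nonneg_left _ hn'.le
        apply ES_mono
        intro A
        calc _ ≤ ∑ _v : Fin n, (Fintype.card α : ℝ) ^ 2 :=
              Finset.sum_le_sum fun v _ => phi_le hU hρ v A
          _ = _ := by simp
    _ = _ := by rw [ES_const hn]; ring

end Meas

set_option linter.unusedSectionVars false

section EntAvg
variable {n : ℕ} {α : Type*} [Fintype α] [DecidableEq α] [Nonempty α]

lemma sum_piecewise (A : Finset (Fin n)) (F : (Fin n → α) → ℝ) :
    ∑ j, F j = (((Fintype.card α : ℝ))⁻¹) ^ n * ∑ j, ∑ k, F (A.piecewise j k) := by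
  let e : (Fin n → α) × (Fin n → α) ≃ (Fin n → α) × (Fin n → α) :=
    { toFun := fun p => (A.piecewise p.1 p.2, A.piecewise p.2 p.1)
      invFun := fun p => (A.piecewise p.1 p.2, A.piecewise p.2 p.1)
      left_inv := fun p => by
        ext u <;> by_cases h : u ∈ A <;> simp [h]
      right_inv := fun p => by
        ext u <;> by_cases h : u ∈ A <;> simp [h] }
  have h := Equiv.sum_comp e (fun p => F p.1)
  simp only [e, Equiv.coe_fn_mk] at h
  rw [Fintype.sum_prod_type, Fintype.sum_prod_type] at h
  rw [h]
  have hα : (Fintype.card α : ℝ) ≠ 0 := by exact_mod_cast Fintype.card_ne_zero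
  simp only [Finset.sum_const, Finset.card_univ, Fintype.card_fun, Fintype.card_fin, nsmul_eq_mul]
  rw [← Finset.mul_sum, ← mul_assoc]
  push_cast
  rw [← mul_pow, inv_mul_cancel₀ hα, one_pow, one_mul]

lemma sum_TT (ρ : Matrix (Fin n → α) (Fin n → α) ℂ) {κ : Type*} [Fintype κ]
    (M : Fin n → κ → Matrix α α ℂ) :
    ∑ k : Fin n → κ, TT ρ (fun u => M u (k u)) = TT ρ (fun u => ∑ i, M u i) := by
  simp only [TT]
  rw [← Matrix.trace_sum, ← Matrix.mul_sum, sum_prodState]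

lemma TT_smul (ρ : Matrix (Fin n → α) (Fin n → α) ℂ) (c : Fin n → ℂ)
    (M : Fin n → Matrix α α ℂ) :
    TT ρ (fun u => c u • M u) = (∏ u, c u) * TT ρ M := by
  simp only [TT]
  rw [← smul_prodState, Matrix.mul_smul, Matrix.trace_smul, smul_eq_mul]

lemma trace_diag_pj (V : Matrix α α ℂ) (hV : V.conjTranspose * V = 1) (c : α → ℂ) (i : α) :
    ((V * Matrix.diagonal c * V.conjTranspose) * pj V i).trace = c i := by
  rw [trace_mul_pj]
  have : V.conjTranspose * (V * Matrix.diagonal c * V.conjTranspose) * V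
      = (V.conjTranspose * V) * Matrix.diagonal c * (V.conjTranspose * V) := by
    simp only [Matrix.mul_assoc]
  rw [this, hV]; simp

def kA (α : Type*) [Fintype α] (A : Finset (Fin n)) : ℝ :=
  ∏ u : Fin n, if u ∈ A then (Fintype.card α : ℝ) else 1

lemma entropy_core {ρ : Matrix (Fin n → α) (Fin n → α) ℂ} (hρ : IsDensity ρ) (A : Finset (Fin n))
    (X V : (Fin n → α) → Fin n → Matrix α α ℂ) (lam : (Fin n → α) → Fin n → α → ℝ)
    (hdX : ∀ j k, X (A.piecewise j k) = X j)
    (hdV : ∀ j k, V (A.piecewise j k) = V j)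
    (hdl : ∀ j k, lam (A.piecewise j k) = lam j)
    (hV : ∀ j u, (V j u).conjTranspose * V j u = 1)
    (hVA : ∀ j j' u, u ∈ A → V j u = V j' u)
    (hXA : ∀ j u, u ∈ A → X j u = pj (V j u) (j u)) (hXn : ∀ j u, u ∉ A → X j u = 1)
    (hl0 : ∀ j u i, 0 ≤ lam j u i) (hl1 : ∀ j u, ∑ i, lam j u i = 1)
    (hlA : ∀ j u i, u ∈ A → lam j u i = (Fintype.card α : ℝ)⁻¹)
    (hrr : ∀ j u, u ∉ A → rr ρ (X j) u =
      V j u * Matrix.diagonal (fun i => (lam j u i : ℂ)) * (V j u).conjTranspose) :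
    entropy ρ ≤ (((Fintype.card α : ℝ))⁻¹) ^ n * (kA α A *
      ∑ j, tau ρ (X j) * ∑ u, (-∑ i, lam j u i * Real.log (lam j u i))) := by
  have hα : (Fintype.card α : ℝ) ≠ 0 := by exact_mod_cast Fintype.card_ne_zero
  have hXp : ∀ j u, (X j u).PosSemidef := by
    intro j u
    by_cases h : u ∈ A
    · rw [hXA j u h]; exact pj_posSemidef _ _
    · rw [hXn j u h]; exact Matrix.PosSemidef.one
  let W : Matrix (Fin n → α) (Fin n → α) ℂ := Matrix.of fun x j => ∏ u, V j u (x u) (j u)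
  have hW : W.conjTranspose * W = 1 := by
    ext j j'
    have e : (W.conjTranspose * W) j j' = ∏ u, ((V j u).conjTranspose * V j' u) (j u) (j' u) := by
      simp only [W, Matrix.mul_apply, Matrix.conjTranspose_apply, Matrix.of_apply, star_prod,
        ← Finset.prod_mul_distrib]
      rw [Finset.prod_univ_sum]; simp
    rw [e]
    by_cases hj : j = j'
    · subst hj; simp [hV]
    rw [Matrix.one_apply_ne hj]
    by_cases hA : ∃ u ∈ A, j u ≠ j' u
    · obtain ⟨u, hu, hne⟩ := hA
      apply Finset.prod_eq_zero (Finset.mem_univ u)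
      rw [hVA j j' u hu, hV, Matrix.one_apply_ne hne]
    · push Not at hA
      have hp : A.piecewise j j' = j' := by
        funext u
        by_cases h : u ∈ A <;> simp [h, hA]
      have h1 := hdV j j'
      rw [hp] at h1
      obtain ⟨u, hu⟩ := Function.ne_iff.mp hj
      apply Finset.prod_eq_zero (Finset.mem_univ u)
      rw [h1, hV, Matrix.one_apply_ne hu]
  set q : (Fin n → α) → ℝ := fun j => tau ρ (fun u => pj (V j u) (j u)) with hq
  have hqW : ∀ j, ((ρ * pj W j).trace).re = q j := by
    intro j
    rw [prod_pj (V j) W j (fun x => rfl)]; rfl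
  set w : (Fin n → α) → ℝ := fun j => ∏ u, lam j u (j u) with hw
  -- tau of the updated tuple
  have htau : ∀ j u (c : α → ℝ), u ∉ A →
      TT ρ (Function.update (X j) u (∑ i, (c i : ℂ) • pj (V j u) i))
        = ((tau ρ (X j) * ∑ i, c i * lam j u i : ℝ) : ℂ) := by
    intro j u c hu
    rw [TT_update_sum]
    push_cast
    rw [Finset.mul_sum]
    refine Finset.sum_congr rfl fun i _ => ?_
    rw [TT_update, ← tau_smul_rr hρ (hXp j) u (hXn j u hu), Matrix.smul_mul, Matrix.trace_smul,
      hrr j u hu, trace_diag_pj _ (hV j u), smul_eq_mul]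
    ring
  -- the summation over the free indices
  have hsum : ∀ j u (c : α → ℝ), u ∉ A →
      ∑ k : Fin n → α, c (k u) * q (A.piecewise j k)
        = kA α A * (tau ρ (X j) * ∑ i, c i * lam j u i) := by
    intro j u c hu
    have h1 : ∀ k : Fin n → α, ((c (k u) * q (A.piecewise j k) : ℝ) : ℂ)
        = TT ρ (fun v => (fun (v : Fin n) (i : α) =>
            if v ∈ A then X j v else if v = u then (c i : ℂ) • pj (V j v) i else pj (V j v) i)
              v (k v)) := by
      intro k
      have e1 : (fun v => (fun (v : Fin n) (i : α) =>
            if v ∈ A then X j v else if v = u then (c i : ℂ) • pj (V j v) i else pj (V j v) i)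
              v (k v)) = fun v => (if v = u then (c (k u) : ℂ) else 1) •
                pj (V (A.piecewise j k) v) ((A.piecewise j k) v) := by
        funext v
        rw [hdV]
        by_cases hvA : v ∈ A
        · have : v ≠ u := by rintro rfl; exact hu hvA
          simp [hvA, this, hXA j v hvA]
        · by_cases hvu : v = u
          · subst hvu; simp [hvA]
          · simp [hvA, hvu]
      rw [e1, TT_smul]
      have e2 : ∏ v : Fin n, (if v = u then (c (k u) : ℂ) else 1) = c (k u) := by simp
      rw [e2]
      push_cast
      rw [hq, tau_cast hρ (fun v => pj_posSemidef _ _)]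
    have h2 : ((∑ k : Fin n → α, c (k u) * q (A.piecewise j k) : ℝ) : ℂ)
        = ((kA α A * (tau ρ (X j) * ∑ i, c i * lam j u i) : ℝ) : ℂ) := by
      rw [Complex.ofReal_sum]
      rw [Finset.sum_congr rfl fun k _ => h1 k]
      rw [sum_TT ρ (fun (v : Fin n) (i : α) =>
            if v ∈ A then X j v else if v = u then (c i : ℂ) • pj (V j v) i else pj (V j v) i),
        Complex.ofReal_mul, ← htau j u c hu]
      have e3 : (fun v => ∑ i, (if v ∈ A then X j v else
            if v = u then (c i : ℂ) • pj (V j v) i else pj (V j v) i))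
          = fun v => (if v ∈ A then (Fintype.card α : ℂ) else 1) •
            Function.update (X j) u (∑ i, (c i : ℂ) • pj (V j u) i) v := by
        funext v
        by_cases hvA : v ∈ A
        · have : v ≠ u := by rintro rfl; exact hu hvA
          simp [hvA, this, Nat.cast_smul_eq_nsmul]
        · by_cases hvu : v = u
          · subst hvu; simp [hvA]
          · simp [hvA, hvu, hXn j v hvA, sum_pj _ (hV j v)]
      rw [e3, TT_smul, kA]
      push_cast
      congr 1
      exact Finset.prod_congr rfl fun v _ => by split_ifs <;> simp
    exact_mod_cast h2
  have hsum1 : ∀ j, ∑ k : Fin n → α, q (A.piecewise j k) = kA α A * tau ρ (X j) := by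
    intro j
    by_cases hA : ∃ u, u ∉ A
    · obtain ⟨u, hu⟩ := hA
      have := hsum j u (fun _ => 1) hu
      simpa [hl1] using this
    · push Not at hA
      have e : ∀ k, q (A.piecewise j k) = tau ρ (X j) := by
        intro k
        rw [hq]
        simp only [hdV]
        congr 1
        funext u
        rw [hXA j u (hA u)]
        simp [hA u]
      simp only [e, kA, hA, if_true]
      simp
  have hwsum : ∑ j, w j ≤ 1 := by
    rw [sum_piecewise A]
    have : ∀ j, ∑ k, w (A.piecewise j k) = 1 := by
      intro j
      have e : ∀ k, w (A.piecewise j k)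
          = ∏ u, (fun (u : Fin n) (i : α) => lam j u i) u (k u) := by
        intro k
        rw [hw]
        simp only [hdl]
        refine Finset.prod_congr rfl fun u _ => ?_
        by_cases h : u ∈ A
        · rw [hlA _ _ _ h, hlA _ _ _ h]
        · simp [h]
      simp only [e]
      have h2 := (Finset.prod_univ_sum (fun _ : Fin n => (Finset.univ : Finset α))
        (fun (u : Fin n) (i : α) => lam j u i))
      rw [Fintype.piFinset_univ] at h2
      rw [← h2]
      simp [hl1]
    simp only [this, Finset.sum_const, Finset.card_univ, Fintype.card_fun, Fintype.card_fin,
      nsmul_eq_mul, mul_one]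
    push_cast
    rw [← mul_pow, inv_mul_cancel₀ hα, one_pow]
  have hq0 : ∀ j, 0 ≤ q j := fun j => tau_nonneg hρ fun u => pj_posSemidef _ _
  have hz' : ∀ j u, lam j u (j u) = 0 → q j = 0 := by
    intro j u h0
    have hu : u ∉ A := by
      intro hu
      rw [hlA _ _ _ hu] at h0
      exact hα (inv_eq_zero.1 h0)
    have h1 := hsum j u (fun i => if i = j u then 1 else 0) hu
    have h2 : ∑ i, (if i = j u then (1 : ℝ) else 0) * lam j u i = 0 := by
      simp [h0]
    rw [h2, mul_zero, mul_zero] at h1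
    have h3 := (Finset.sum_eq_zero_iff_of_nonneg (fun k _ => mul_nonneg
      (by split_ifs <;> norm_num) (hq0 _))).1 h1 j (Finset.mem_univ j)
    have hp : A.piecewise j j = j := by
      funext v
      by_cases h : v ∈ A <;> simp [h]
    rw [hp] at h3
    simpa using h3
  have hz : ∀ j, w j = 0 → ((ρ * pj W j).trace).re = 0 := by
    intro j hj
    rw [hqW]
    obtain ⟨u, _, hu⟩ := Finset.prod_eq_zero_iff.1 hj
    exact hz' j u hu
  have main := entropy_le hρ W hW w (fun j => Finset.prod_nonneg fun u _ => hl0 _ _ _) hwsum hz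
  refine main.trans (le_of_eq ?_)
  simp only [hqW]
  have hlog : ∀ j, q j * Real.log (w j) = ∑ u, q j * Real.log (lam j u (j u)) := by
    intro j
    by_cases h0 : ∃ u, lam j u (j u) = 0
    · obtain ⟨u, hu⟩ := h0
      simp [hz' j u hu]
    · push Not at h0
      rw [hw]
      simp only
      rw [Real.log_prod (fun u _ => h0 u), Finset.mul_sum]
  have hper : ∀ j u, ∑ k : Fin n → α,
      q (A.piecewise j k) * Real.log (lam (A.piecewise j k) u ((A.piecewise j k) u))
        = kA α A * (tau ρ (X j) * ∑ i, lam j u i * Real.log (lam j u i)) := by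
    intro j u
    by_cases hu : u ∈ A
    · simp only [hlA _ _ _ hu]
      rw [← Finset.sum_mul, hsum1]
      simp only [Finset.sum_const, Finset.card_univ, nsmul_eq_mul]
      rw [← mul_assoc (Fintype.card α : ℝ), mul_inv_cancel₀ hα]
      ring
    · have := hsum j u (fun i => Real.log (lam j u i)) hu
      simp only [hdl]
      rw [Finset.sum_congr rfl fun i _ => mul_comm (lam j u i) (Real.log (lam j u i)), ← this]
      refine Finset.sum_congr rfl fun k _ => ?_
      simp [hu, mul_comm]
  simp only [hlog]
  rw [Finset.sum_comm]
  have hstep : ∀ u, ∑ j, q j * Real.log (lam j u (j u)) = (((Fintype.card α : ℝ))⁻¹) ^ n *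
      ∑ j, kA α A * (tau ρ (X j) * ∑ i, lam j u i * Real.log (lam j u i)) := by
    intro u
    rw [sum_piecewise A]
    simp only [hper]
  simp only [hstep]
  rw [← Finset.mul_sum, ← mul_neg, Finset.sum_comm, ← Finset.sum_neg_distrib]
  congr 1
  rw [Finset.mul_sum]
  refine Finset.sum_congr rfl fun j _ => ?_
  rw [← Finset.mul_sum, ← Finset.mul_sum, Finset.sum_neg_distrib]
  ring

lemma exists_diag (Z : Matrix α α ℂ) : ∃ (V : Matrix α α ℂ) (lam : α → ℝ), IsDensity Z →
    (V.conjTranspose * V = 1 ∧ (∀ i, 0 ≤ lam i) ∧ ∑ i, lam i = 1 ∧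
      Z = V * Matrix.diagonal (fun i => (lam i : ℂ)) * V.conjTranspose) := by
  by_cases h : IsDensity Z
  · obtain ⟨V, h1, h2⟩ := spectral' h.1.1
    exact ⟨V, h.1.1.eigenvalues, fun _ => ⟨h1, h.1.eigenvalues_nonneg, sum_eigenvalues h, h2⟩⟩
  · exact ⟨1, 0, fun h' => absurd h' h⟩

variable {B : Type*} [Fintype B] [Nonempty B]

lemma entropy_avg {U : B → Matrix α α ℂ} (hU : ∀ b, (U b).conjTranspose * U b = 1)
    {ρ : Matrix (Fin n → α) (Fin n → α) ℂ} (hρ : IsDensity ρ) (A : Finset (Fin n)) :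
    entropy ρ ≤ NN A (fun ω : Fin n → B × α =>
      tau ρ (XA U A ω) * ∑ u, entropy (sg ρ U A ω u)) := by
  have hα : (Fintype.card α : ℝ) ≠ 0 := by exact_mod_cast Fintype.card_ne_zero
  have hB : (Fintype.card B : ℝ) ≠ 0 := by exact_mod_cast Fintype.card_ne_zero
  choose Vc lc hc using (exists_diag (α := α))
  have one : ∀ b : Fin n → B, entropy ρ ≤ (((Fintype.card α : ℝ))⁻¹) ^ n * (kA α A *
      ∑ j : Fin n → α, tau ρ (XA U A (fun u => (b u, j u))) *
        ∑ u, entropy (sg ρ U A (fun u => (b u, j u)) u)) := by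
    intro b
    have hdX : ∀ j k : Fin n → α, XA U A (fun u => (b u, A.piecewise j k u))
        = XA U A (fun u => (b u, j u)) := by
      intro j k
      funext u
      by_cases h : u ∈ A <;> simp [XA, h]
    have hds : ∀ j k : Fin n → α, sg ρ U A (fun u => (b u, A.piecewise j k u))
        = sg ρ U A (fun u => (b u, j u)) := by
      intro j k
      funext u
      simp only [sg, hdX]
    have hsgd : ∀ (j : Fin n → α) u, IsDensity (sg ρ U A (fun u => (b u, j u)) u) :=
      fun j u => sg_density hρ A _ u
    have hmm : ∀ b, mm α = U b * Matrix.diagonal (fun _ => (((Fintype.card α : ℝ)⁻¹ : ℝ) : ℂ))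
        * (U b).conjTranspose := by
      intro b
      rw [mm, ← Matrix.smul_one_eq_diagonal, Matrix.mul_smul, Matrix.mul_one, Matrix.smul_mul,
        mul_eq_one_comm.mp (hU b)]
      push_cast; rfl
    set V : (Fin n → α) → Fin n → Matrix α α ℂ := fun j u =>
      if u ∈ A then U (b u) else Vc (sg ρ U A (fun u => (b u, j u)) u) with hVdef
    set lam : (Fin n → α) → Fin n → α → ℝ := fun j u i =>
      if u ∈ A then (Fintype.card α : ℝ)⁻¹ else lc (sg ρ U A (fun u => (b u, j u)) u) i with hldef
    have hV : ∀ j u, (V j u).conjTranspose * V j u = 1 := by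
      intro j u
      by_cases h : u ∈ A
      · simp only [hVdef, h, if_true]; exact hU _
      · simp only [hVdef, h, if_false]; exact (hc _ (hsgd j u)).1
    have hl0 : ∀ j u i, 0 ≤ lam j u i := by
      intro j u i
      by_cases h : u ∈ A
      · simp only [hldef, h, if_true]; positivity
      · simp only [hldef, h, if_false]; exact (hc _ (hsgd j u)).2.1 i
    have hl1 : ∀ j u, ∑ i, lam j u i = 1 := by
      intro j u
      by_cases h : u ∈ A
      · simp only [hldef, h, if_true]; simp [hα]
      · simp only [hldef, h, if_false]; exact (hc _ (hsgd j u)).2.2.1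
    have hsg : ∀ j u, sg ρ U A (fun u => (b u, j u)) u =
        V j u * Matrix.diagonal (fun i => (lam j u i : ℂ)) * (V j u).conjTranspose := by
      intro j u
      by_cases h : u ∈ A
      · simp only [hVdef, hldef, h, if_true]
        rw [sg, if_pos h]; exact hmm (b u)
      · simp only [hVdef, hldef, h, if_false]; exact (hc _ (hsgd j u)).2.2.2
    have core := entropy_core hρ A (fun j => XA U A (fun u => (b u, j u))) V lam hdX
      (fun j k => by simp only [hVdef, hds]) (fun j k => by simp only [hldef, hds]) hV
      (fun j j' u hu => by simp only [hVdef, hu, if_true])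
      (fun j u hu => by simp only [hVdef, XA, hu, if_true, QQ])
      (fun j u hu => by simp only [XA, hu, if_false]) hl0 hl1
      (fun j u i hu => by simp only [hldef, hu, if_true])
      (fun j u hu => by rw [← hsg j u, sg, if_neg hu])
    refine core.trans ?_
    apply mul_le_mul_of_nonneg_left _ (by positivity)
    apply mul_le_mul_of_nonneg_left _
      (Finset.prod_nonneg fun u _ => by split_ifs <;> positivity)
    apply Finset.sum_le_sum
    intro j _
    apply mul_le_mul_of_nonneg_left _ (tau_nonneg hρ (XA_psd A _))
    apply Finset.sum_le_sum
    intro u _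
    exact entropy_ge (hsgd j u) (V j u) (hV j u) (lam j u) (hl0 j u) (hsg j u)
  have h := Finset.sum_le_sum fun b (_ : b ∈ (Finset.univ : Finset (Fin n → B))) => one b
  simp only [Finset.sum_const, Finset.card_univ, Fintype.card_fun, Fintype.card_fin,
    nsmul_eq_mul] at h
  rw [← Finset.mul_sum, ← Finset.mul_sum] at h
  push_cast at h
  have hwt : wt α B A = ((Fintype.card B : ℝ)⁻¹) ^ n *
      ((((Fintype.card α : ℝ))⁻¹) ^ n * kA α A) := by
    have hp : ∀ c : ℝ, c ^ n = ∏ _u : Fin n, c := fun c => by simp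
    rw [wt, kA, hp, hp, ← Finset.prod_mul_distrib, ← Finset.prod_mul_distrib]
    refine Finset.prod_congr rfl fun u _ => ?_
    rw [Fintype.card_prod]
    push_cast
    split_ifs
    · field_simp
    · field_simp
  have hsumω : ∀ G : (Fin n → B × α) → ℝ, ∑ ω, G ω = ∑ b : Fin n → B, ∑ j : Fin n → α,
      G (fun u => (b u, j u)) := by
    intro G
    rw [← Fintype.sum_prod_type' (f := fun (b : Fin n → B) (j : Fin n → α) =>
      G (fun u => (b u, j u)))]
    exact (Equiv.sum_comp (Equiv.arrowProdEquivProdArrow (Fin n) (fun _ => B) (fun _ => α)).symm G).symm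
  rw [NN, hwt, hsumω]
  calc entropy ρ = ((Fintype.card B : ℝ)⁻¹) ^ n * ((Fintype.card B : ℝ) ^ n * entropy ρ) := by
        rw [← mul_assoc, ← mul_pow, inv_mul_cancel₀ hB, one_pow, one_mul]
    _ ≤ _ := mul_le_mul_of_nonneg_left h (by positivity)
    _ = _ := by ring

end EntAvg

set_option linter.unusedSectionVars false

section Tomo
variable {α : Type*} [Fintype α] [DecidableEq α]

lemma tomo_herm (Z : Matrix α α ℂ) (hZ : Z.IsHermitian) :
    ∃ (V : Matrix α α ℂ) (c : α → ℂ), V.conjTranspose * V = 1 ∧ Z = ∑ i, c i • pj V i := by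
  obtain ⟨V, hV, h⟩ := spectral' hZ
  exact ⟨V, _, hV, by rw [sum_smul_pj]; exact h⟩

def herm2 (p : α × α × Bool) : Matrix α α ℂ :=
  if p.2.2 then Matrix.single p.1 p.2.1 1 + Matrix.single p.2.1 p.1 1
  else (Complex.I • (Matrix.single p.1 p.2.1 (1 : ℂ) - Matrix.single p.2.1 p.1 1))

lemma herm2_herm (p : α × α × Bool) : (herm2 p).IsHermitian := by
  rw [Matrix.IsHermitian, herm2]
  split_ifs
  · simp [add_comm]
  · rw [Matrix.conjTranspose_smul, Matrix.conjTranspose_sub, Matrix.conjTranspose_single,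
      Matrix.conjTranspose_single, star_one, ← neg_sub, smul_neg, ← neg_smul]
    congr 1
    simp

lemma single_herm2 (i j : α) : Matrix.single i j (1 : ℂ)
    = (1 / 2 : ℂ) • herm2 (i, j, true) + (-(Complex.I / 2)) • herm2 (i, j, false) := by
  have : -(Complex.I / 2) * Complex.I = 1 / 2 := by
    linear_combination (-1 / 2 : ℂ) * Complex.I_mul_I
  simp only [herm2, if_true, if_false, smul_smul, this, Bool.false_eq_true]
  rw [← smul_add, add_add_sub_cancel, ← two_smul ℂ (Matrix.single i j (1 : ℂ)), smul_smul]
  norm_num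

lemma tomo (α : Type*) [Fintype α] [DecidableEq α] :
    ∃ (U : α × α × Bool → Matrix α α ℂ) (c : α → α → ((α × α × Bool) × α) → ℂ),
    (∀ b, (U b).conjTranspose * U b = 1) ∧
      ∀ i j, Matrix.single i j (1 : ℂ) = ∑ x, c i j x • QQ U x := by
  choose U c hU hc using fun p : α × α × Bool => tomo_herm (herm2 p) (herm2_herm p)
  refine ⟨U, fun i j x => (if x.1 = (i, j, true) then (1 / 2 : ℂ) else
    if x.1 = (i, j, false) then -(Complex.I / 2) else 0) * c x.1 x.2, hU, fun i j => ?_⟩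
  rw [Fintype.sum_prod_type]
  have e : ∀ b : α × α × Bool, ∑ y, (((if b = (i, j, true) then (1 / 2 : ℂ) else
    if b = (i, j, false) then -(Complex.I / 2) else 0) * c b y) • QQ U (b, y)) =
      (if b = (i, j, true) then (1 / 2 : ℂ) else
    if b = (i, j, false) then -(Complex.I / 2) else 0) • herm2 b := by
    intro b
    rw [hc b, Finset.smul_sum]
    exact Finset.sum_congr rfl fun y _ => mul_smul _ _ _
  rw [Finset.sum_congr rfl fun b _ => e b]
  rw [single_herm2 i j, ← Finset.add_sum_erase _ _ (Finset.mem_univ (i, j, true)),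
    ← Finset.add_sum_erase _ _ (show (i, j, false) ∈ Finset.univ.erase (i, j, true) by simp),
    Finset.sum_eq_zero]
  · simp
  · intro b hb
    simp only [Finset.mem_erase] at hb
    rw [if_neg hb.2.1, if_neg hb.1, zero_smul]

end Tomo

section OpN
variable {m : Type*} [Fintype m] [DecidableEq m]

lemma opNorm_nonneg (A : Matrix m m ℂ) : 0 ≤ opNorm A := norm_nonneg _

lemma norm_sum_le_opNorm (A : Matrix m m ℂ) (x y : m → ℂ) (r : ℝ)
    (hx : ∑ i, ‖x i‖ ^ 2 = r) (hy : ∑ i, ‖y i‖ ^ 2 = r) :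
    ‖∑ i, ∑ j, star (x i) * A i j * y j‖ ≤ opNorm A * r := by
  have h1 := norm_inner_le_norm (𝕜 := ℂ) (WithLp.toLp 2 x)
    (Matrix.toEuclideanCLM (𝕜 := ℂ) A (WithLp.toLp 2 y))
  have h2 := (Matrix.toEuclideanCLM (𝕜 := ℂ) A).le_opNorm (WithLp.toLp 2 y)
  have hr : 0 ≤ r := by rw [← hx]; positivity
  have hx' : ‖(WithLp.toLp 2 x : EuclideanSpace ℂ m)‖ = Real.sqrt r := by
    rw [EuclideanSpace.norm_eq, ← hx]
  have hy' : ‖(WithLp.toLp 2 y : EuclideanSpace ℂ m)‖ = Real.sqrt r := by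
    rw [EuclideanSpace.norm_eq, ← hy]
  rw [hy'] at h2
  rw [hx'] at h1
  have h3 : inner ℂ (WithLp.toLp 2 x : EuclideanSpace ℂ m)
      (Matrix.toEuclideanCLM (𝕜 := ℂ) A (WithLp.toLp 2 y))
      = ∑ i, ∑ j, star (x i) * A i j * y j := by
    rw [PiLp.inner_apply]
    refine Finset.sum_congr rfl fun i _ => ?_
    simp [Matrix.mulVec, dotProduct, Finset.sum_mul]
    refine Finset.sum_congr rfl fun j _ => ?_
    ring
  rw [h3] at h1
  refine h1.trans ((mul_le_mul_of_nonneg_left h2 (Real.sqrt_nonneg _)).trans (le_of_eq ?_))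
  rw [opNorm]
  linear_combination ‖Matrix.toEuclideanCLM (𝕜 := ℂ) A‖ * Real.mul_self_sqrt hr

lemma entry_le_opNorm (A : Matrix m m ℂ) (i j : m) : ‖A i j‖ ≤ opNorm A := by
  have := norm_sum_le_opNorm A (Pi.single i 1) (Pi.single j 1) 1
    (by rw [Finset.sum_eq_single i] <;> simp +contextual)
    (by rw [Finset.sum_eq_single j] <;> simp +contextual)
  simpa [Pi.single_apply] using this

lemma energy_le_opNorm (A ρ : Matrix m m ℂ) (hρ : IsDensity ρ) : |energy A ρ| ≤ opNorm A := by
  obtain ⟨Y, hY⟩ := exists_conjTranspose_mul_self hρ.1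
  have h1 : (A * ρ).trace = ∑ k, ∑ i, ∑ j, star (star (Y k i)) * A i j * star (Y k j) := by
    rw [hY, ← Matrix.mul_assoc, Matrix.trace_mul_comm, ← Matrix.mul_assoc]
    simp only [Matrix.trace, Matrix.diag, Matrix.mul_apply, Matrix.conjTranspose_apply, star_star,
      Finset.sum_mul]
    exact Finset.sum_congr rfl fun k _ => Finset.sum_comm
  have h2 : ∑ k, ∑ i, ‖star (Y k i)‖ ^ 2 = 1 := by
    have h := hρ.2
    rw [hY] at h
    simp only [Matrix.trace, Matrix.diag, Matrix.mul_apply, Matrix.conjTranspose_apply] at h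
    rw [Finset.sum_comm]
    have e : ∀ z : ℂ, star z * z = ((‖star z‖ ^ 2 : ℝ) : ℂ) := by
      intro z
      rw [norm_star, ← Complex.normSq_eq_norm_sq, Complex.normSq_eq_conj_mul_self]; rfl
    simp only [e] at h
    exact_mod_cast h
  calc |energy A ρ| ≤ ‖(A * ρ).trace‖ := Complex.abs_re_le_norm _
    _ ≤ ∑ k, opNorm A * ∑ i, ‖star (Y k i)‖ ^ 2 := by
        rw [h1]
        refine (norm_sum_le _ _).trans (Finset.sum_le_sum fun k _ => ?_)
        exact norm_sum_le_opNorm A _ _ _ rfl rfl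
    _ = _ := by rw [← Finset.mul_sum, h2, mul_one]

end OpN

section Dec
variable {n : ℕ} {α : Type*} [Fintype α] [DecidableEq α]

/-- the two-site elementary tuple -/
def EE (X : Fin n → Matrix α α ℂ) (u v : Fin n) (p : α × α) (q : α × α) : Fin n → Matrix α α ℂ :=
  Function.update (Function.update X u (Matrix.single p.1 p.2 1)) v (Matrix.single q.1 q.2 1)

lemma EE_apply (u v : Fin n) (huv : u ≠ v) (p q : α × α) (x y : Fin n → α) :
    prodState (EE (fun _ => 1) u v p q) x y =
      if (x u, y u) = p ∧ (x v, y v) = q ∧ ∀ w, w ≠ u → w ≠ v → x w = y w then 1 else 0 := by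
  split_ifs with h
  · obtain ⟨rfl, rfl, h⟩ := h
    rw [prodState]
    refine Finset.prod_eq_one fun w _ => ?_
    by_cases hv : w = v
    · subst hv; simp [EE]
    · by_cases hu : w = u
      · subst hu; simp [EE, huv]
      · simp [EE, hu, hv, h w hu hv]
  · rw [prodState]
    by_contra hne
    apply h
    replace hne := Finset.prod_ne_zero_iff.1 hne
    refine ⟨?_, ?_, fun w hu hv => ?_⟩
    · have := hne u (Finset.mem_univ u)
      simp only [EE, Function.update_of_ne huv, Function.update_self] at this
      by_contra hp
      apply this
      rw [Matrix.single_apply_of_ne]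
      rintro ⟨h1, h2⟩; exact hp (by rw [← h1, ← h2])
    · have := hne v (Finset.mem_univ v)
      simp only [EE, Function.update_self] at this
      by_contra hp
      apply this
      rw [Matrix.single_apply_of_ne]
      rintro ⟨h1, h2⟩; exact hp (by rw [← h1, ← h2])
    · have := hne w (Finset.mem_univ w)
      simp only [EE, Function.update_of_ne hv, Function.update_of_ne hu] at this
      by_contra hp
      exact this (Matrix.one_apply_ne hp)

lemma actsOn_decomp [Nonempty α] (h : Matrix (Fin n → α) (Fin n → α) ℂ) (u v : Fin n) (huv : u ≠ v)
    (hh : ActsOn h {u, v}) : ∃ μ : α × α → α × α → ℂ, (∀ p q, ‖μ p q‖ ≤ opNorm h) ∧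
      h = ∑ p, ∑ q, μ p q • prodState (EE (fun _ => 1) u v p q) := by
  obtain ⟨M, hM⟩ := hh
  let z : Fin n → α := fun _ => Classical.arbitrary α
  let g : α → α → Fin n → α := fun a b => Function.update (Function.update z u a) v b
  refine ⟨fun p q => h (g p.1 q.1) (g p.2 q.2), fun p q => entry_le_opNorm _ _ _, ?_⟩
  ext x y
  simp only [Matrix.sum_apply, Matrix.smul_apply, EE_apply u v huv, smul_eq_mul]
  rw [Finset.sum_eq_single (x u, y u), Finset.sum_eq_single (x v, y v)]
  · have hg : ∀ x : Fin n → α, (fun w : {w // w ∈ ({u, v} : Finset (Fin n))} => g (x u) (x v) w.1)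
        = fun w => x w.1 := by
      intro x
      funext ⟨w, hw⟩
      by_cases hv : w = v
      · subst hv; simp [g]
      · have : w = u := by simpa [hv] using hw
        subst this; simp [g, huv]
    have hout : ∀ w ∉ ({u, v} : Finset (Fin n)), g (x u) (x v) w = g (y u) (y v) w := by
      intro w hw
      simp only [Finset.mem_insert, Finset.mem_singleton, not_or] at hw
      simp [g, hw.1, hw.2]
    rw [hM x y, hM (g (x u) (x v)), hg, hg, if_pos hout, one_mul, mul_comm]
    simp
  · intro q _ hq
    rw [if_neg, mul_zero]
    rintro ⟨_, h2, _⟩; exact hq h2.symm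
  · simp
  · intro p _ hp
    refine Finset.sum_eq_zero fun q _ => ?_
    rw [if_neg, mul_zero]
    rintro ⟨h2, _⟩; exact hp h2.symm
  · simp

end Dec

set_option linter.unusedSectionVars false

section Edge
variable {n : ℕ} {α B : Type*} [Fintype α] [DecidableEq α] [Fintype B] [Nonempty α] [Nonempty B]
variable {U : B → Matrix α α ℂ} {ρ : Matrix (Fin n → α) (Fin n → α) ℂ}
variable {c : α → α → (B × α) → ℂ}

lemma TT_single (X : Fin n → Matrix α α ℂ) (v : Fin n) (i j : α) :
    TT ρ (Function.update X v (Matrix.single i j 1)) = RR ρ X v j i := rfl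

lemma err_id (hc : ∀ i j, Matrix.single i j (1 : ℂ) = ∑ x, c i j x • QQ U x) (hρ : IsDensity ρ)
    (X : Fin n → Matrix α α ℂ) (hX : ∀ u, (X u).PosSemidef) (u v : Fin n) (huv : u ≠ v)
    (hu : X u = 1) (hv : X v = 1) (p q : α × α) :
    TT ρ (EE X u v p q) - (tau ρ X : ℂ) * (rr ρ X u p.2 p.1 * rr ρ X v q.2 q.1)
      = ∑ x, c p.1 p.2 x * ((tau ρ (Function.update X u (QQ U x)) : ℂ) *
        (rr ρ (Function.update X u (QQ U x)) v q.2 q.1 - rr ρ X v q.2 q.1)) := by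
  have h1 : TT ρ (EE X u v p q) = ∑ x, c p.1 p.2 x *
      ((tau ρ (Function.update X u (QQ U x)) : ℂ) *
        rr ρ (Function.update X u (QQ U x)) v q.2 q.1) := by
    rw [EE, Function.update_comm huv, hc p.1 p.2, TT_update_sum]
    refine Finset.sum_congr rfl fun x _ => ?_
    rw [Function.update_comm huv.symm, TT_single,
      ← tau_smul_rr hρ (upd_psd X hX u x) v (by rw [Function.update_of_ne huv.symm, hv])]
    rfl
  have h2 : (tau ρ X : ℂ) * rr ρ X u p.2 p.1 = ∑ x, c p.1 p.2 x *
      (tau ρ (Function.update X u (QQ U x)) : ℂ) := by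
    have e : (tau ρ X : ℂ) * rr ρ X u p.2 p.1 = RR ρ X u p.2 p.1 := by
      rw [← tau_smul_rr hρ hX u hu]; rfl
    rw [e, ← TT_single, hc p.1 p.2, TT_update_sum]
    refine Finset.sum_congr rfl fun x _ => ?_
    rw [tau_cast hρ (upd_psd X hX u x)]
  rw [← mul_assoc, h1, h2, Finset.sum_mul, ← Finset.sum_sub_distrib]
  exact Finset.sum_congr rfl fun x _ => by ring

lemma entry_sq_le_nsq (Z : Matrix α α ℂ) (i j : α) : ‖Z i j‖ ^ 2 ≤ nsq Z := by
  rw [nsq]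
  refine le_trans ?_ (Finset.single_le_sum (f := fun i => ∑ j, ‖Z i j‖ ^ 2)
    (fun i _ => by positivity) (Finset.mem_univ i))
  exact Finset.single_le_sum (f := fun j => ‖Z i j‖ ^ 2) (fun i _ => by positivity)
    (Finset.mem_univ j)

lemma amgm (θ J δ s : ℝ) (hθ : 0 < θ) (hs : δ ^ 2 ≤ s) :
    J * δ ≤ θ * J ^ 2 / 2 + s / (2 * θ) := by
  have h : J * δ ≤ θ * J ^ 2 / 2 + δ ^ 2 / (2 * θ) := by
    have : θ * J ^ 2 / 2 + δ ^ 2 / (2 * θ) - J * δ = (θ * J - δ) ^ 2 / (2 * θ) := by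
      field_simp; ring
    have h2 : 0 ≤ (θ * J - δ) ^ 2 / (2 * θ) := by positivity
    linarith
  refine h.trans ?_
  gcongr

lemma err_bound (hc : ∀ i j, Matrix.single i j (1 : ℂ) = ∑ x, c i j x • QQ U x) (hρ : IsDensity ρ)
    (Cm : ℝ) (hCm : ∀ i j x, ‖c i j x‖ ≤ Cm)
    (X : Fin n → Matrix α α ℂ) (hX : ∀ u, (X u).PosSemidef) (u v : Fin n) (huv : u ≠ v)
    (hu : X u = 1) (hv : X v = 1) (p q : α × α) (θ J : ℝ) (hθ : 0 < θ) (hJ : 0 ≤ J) :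
    J * ‖TT ρ (EE X u v p q) - (tau ρ X : ℂ) * (rr ρ X u p.2 p.1 * rr ρ X v q.2 q.1)‖
      ≤ ∑ x, Cm * (tau ρ (Function.update X u (QQ U x)) *
        (θ * J ^ 2 / 2 + nsq (rr ρ (Function.update X u (QQ U x)) v - rr ρ X v) / (2 * θ))) := by
  rw [err_id hc hρ X hX u v huv hu hv]
  calc _ ≤ J * ∑ x, ‖c p.1 p.2 x * ((tau ρ (Function.update X u (QQ U x)) : ℂ) *
        (rr ρ (Function.update X u (QQ U x)) v q.2 q.1 - rr ρ X v q.2 q.1))‖ :=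
        mul_le_mul_of_nonneg_left (norm_sum_le _ _) hJ
    _ ≤ _ := by
      rw [Finset.mul_sum]
      refine Finset.sum_le_sum fun x _ => ?_
      have ht := tau_nonneg hρ (upd_psd (U := U) X hX u x)
      have h1 := amgm θ J _ _ hθ (entry_sq_le_nsq
        (rr ρ (Function.update X u (QQ U x)) v - rr ρ X v) q.2 q.1)
      rw [Matrix.sub_apply] at h1
      rw [norm_mul, norm_mul, Complex.norm_real, Real.norm_of_nonneg ht]
      have h2 := mul_le_mul (hCm p.1 p.2 x) (mul_le_mul_of_nonneg_left h1 ht)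
        (by positivity) ((norm_nonneg _).trans (hCm p.1 p.2 x))
      linarith

lemma TT_prod (σ : Fin n → Matrix α α ℂ) (hσ : ∀ u, IsDensity (σ u)) (u v : Fin n) (huv : u ≠ v)
    (p q : α × α) :
    TT (prodState σ) (EE (fun _ => 1) u v p q) = σ u p.2 p.1 * σ v q.2 q.1 := by
  rw [TT, prodState_mul, trace_prodState]
  have e : ∀ w, (σ w * EE (fun _ => 1) u v p q w).trace
      = (if w = u then σ u p.2 p.1 else 1) * (if w = v then σ v q.2 q.1 else 1) := by
    intro w
    by_cases hv : w = v
    · subst hv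
      simp [EE, huv.symm, Matrix.trace_mul_single]
    · by_cases hu : w = u
      · subst hu
        simp [EE, huv, Matrix.trace_mul_single]
      · simp [EE, hu, hv, (hσ w).2]
  simp only [e, Finset.prod_mul_distrib]
  simp

lemma NN_EE (hU : ∀ b, (U b).conjTranspose * U b = 1) (A : Finset (Fin n)) (u v : Fin n)
    (hu : u ∉ A) (hv : v ∉ A) (p q : α × α) :
    (wt α B A : ℂ) * ∑ ω : Fin n → B × α, TT ρ (EE (XA U A ω) u v p q)
      = TT ρ (EE (fun _ => 1) u v p q) := by
  have h := NN_TT hU ρ A (EE (fun _ => 1) u v p q)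
  have e1 : ∀ ω : Fin n → B × α, EE (XA U A ω) u v p q
      = fun w => if w ∈ A then QQ U (ω w) else EE (fun _ => 1) u v p q w := by
    intro ω
    funext w
    by_cases hv' : w = v
    · subst hv'; simp [EE, hv]
    · by_cases hu' : w = u
      · subst hu'; simp [EE, hu, hv']
      · simp [EE, hu', hv', XA]
  have e2 : (fun w => if w ∈ A then (1 : Matrix α α ℂ) else EE (fun _ => 1) u v p q w)
      = EE (fun _ => 1) u v p q := by
    funext w
    by_cases hv' : w = v
    · subst hv'; simp [EE, hv]
    · by_cases hu' : w = u
      · subst hu'; simp [EE, hu, hv']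
      · simp [EE, hu', hv']
  rw [e2] at h
  rw [← h]
  simp only [e1]

lemma energy_EE (h : Matrix (Fin n → α) (Fin n → α) ℂ) (u v : Fin n) (μ : α × α → α × α → ℂ)
    (hμ : h = ∑ p, ∑ q, μ p q • prodState (EE (fun _ => 1) u v p q))
    (ρ : Matrix (Fin n → α) (Fin n → α) ℂ) :
    energy h ρ = ∑ p, ∑ q, (μ p q * TT ρ (EE (fun _ => 1) u v p q)).re := by
  rw [energy, Matrix.trace_mul_comm]
  conv_lhs => rw [hμ]
  simp only [Matrix.mul_sum, Matrix.trace_sum, Matrix.mul_smul, Matrix.trace_smul, Complex.re_sum,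
    smul_eq_mul, TT]

lemma edge_point (hc : ∀ i j, Matrix.single i j (1 : ℂ) = ∑ x, c i j x • QQ U x)
    (hρ : IsDensity ρ) (Cm : ℝ) (hCm : ∀ i j x, ‖c i j x‖ ≤ Cm)
    (h : Matrix (Fin n → α) (Fin n → α) ℂ) (u v : Fin n) (huv : u ≠ v) (μ : α × α → α × α → ℂ)
    (hμ : h = ∑ p, ∑ q, μ p q • prodState (EE (fun _ => 1) u v p q))
    (hμn : ∀ p q, ‖μ p q‖ ≤ opNorm h)
    (A : Finset (Fin n)) (hu : u ∉ A) (hv : v ∉ A) (θ : ℝ) (hθ : 0 < θ) (ω : Fin n → B × α) :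
    tau ρ (XA U A ω) * energy h (prodState (sg ρ U A ω)) ≤
      ∑ p, ∑ q, (μ p q * TT ρ (EE (XA U A ω) u v p q)).re +
      (Fintype.card α : ℝ) ^ 4 * ∑ x, Cm * (tau ρ (Function.update (XA U A ω) u (QQ U x)) *
        (θ * opNorm h ^ 2 / 2 + nsq (rr ρ (Function.update (XA U A ω) u (QQ U x)) v
          - rr ρ (XA U A ω) v) / (2 * θ))) := by
  set R := ∑ x, Cm * (tau ρ (Function.update (XA U A ω) u (QQ U x)) *
        (θ * opNorm h ^ 2 / 2 + nsq (rr ρ (Function.update (XA U A ω) u (QQ U x)) v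
          - rr ρ (XA U A ω) v) / (2 * θ))) with hR
  have hcard : (Fintype.card α : ℝ) ^ 4 * R = ∑ _p : α × α, ∑ _q : α × α, R := by
    simp; ring
  rw [hcard, energy_EE h u v μ hμ, Finset.mul_sum, ← Finset.sum_add_distrib]
  refine Finset.sum_le_sum fun p _ => ?_
  rw [Finset.mul_sum, ← Finset.sum_add_distrib]
  refine Finset.sum_le_sum fun q _ => ?_
  rw [TT_prod _ (sg_density hρ A ω) u v huv]
  have hsu : sg ρ U A ω u = rr ρ (XA U A ω) u := by simp [sg, hu]
  have hsv : sg ρ U A ω v = rr ρ (XA U A ω) v := by simp [sg, hv]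
  rw [hsu, hsv, ← Complex.re_ofReal_mul]
  have hb := err_bound hc hρ Cm hCm (XA U A ω) (XA_psd A ω) u v huv (by simp [XA, hu])
    (by simp [XA, hv]) p q θ (opNorm h) hθ (opNorm_nonneg h)
  rw [← hR] at hb
  refine le_trans ?_ (add_le_add_right hb _)
  have h3 := mul_le_mul_of_nonneg_right (hμn p q) (norm_nonneg (TT ρ (EE (XA U A ω) u v p q) -
    (tau ρ (XA U A ω) : ℂ) * (rr ρ (XA U A ω) u p.2 p.1 * rr ρ (XA U A ω) v q.2 q.1)))
  refine le_trans ?_ (add_le_add_right h3 _)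
  rw [← norm_mul]
  have h4 := (neg_le_abs _).trans (Complex.abs_re_le_norm (μ p q * (TT ρ (EE (XA U A ω) u v p q) -
    (tau ρ (XA U A ω) : ℂ) * (rr ρ (XA U A ω) u p.2 p.1 * rr ρ (XA U A ω) v q.2 q.1))))
  rw [mul_sub, Complex.sub_re] at h4
  rw [mul_sub]
  have h5 : (tau ρ (XA U A ω) : ℂ) * (μ p q * (rr ρ (XA U A ω) u p.2 p.1 * rr ρ (XA U A ω) v q.2 q.1))
    = μ p q * ((tau ρ (XA U A ω) : ℂ) * (rr ρ (XA U A ω) u p.2 p.1 * rr ρ (XA U A ω) v q.2 q.1)) := by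
    ring
  rw [h5]
  linarith

lemma edge_alive (hU : ∀ b, (U b).conjTranspose * U b = 1)
    (hc : ∀ i j, Matrix.single i j (1 : ℂ) = ∑ x, c i j x • QQ U x)
    (hρ : IsDensity ρ) (Cm : ℝ) (hCm : ∀ i j x, ‖c i j x‖ ≤ Cm)
    (h : Matrix (Fin n → α) (Fin n → α) ℂ) (u v : Fin n) (huv : u ≠ v) (hh : ActsOn h {u, v})
    (A : Finset (Fin n)) (hu : u ∉ A) (hv : v ∉ A) (θ : ℝ) (hθ : 0 < θ) :
    NN A (fun ω => tau ρ (XA U A ω) * energy h (prodState (sg ρ U A ω))) ≤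
      energy h ρ + ((Fintype.card α : ℝ) ^ 4 * Cm * Fintype.card B) *
        (θ * opNorm h ^ 2 / 2 + DD ρ U u v A / (2 * θ)) := by
  obtain ⟨μ, hμn, hμ⟩ := actsOn_decomp h u v huv hh
  refine (NN_mono A (edge_point hc hρ Cm hCm h u v huv μ hμ hμn A hu hv θ hθ)).trans ?_
  rw [NN_add]
  refine add_le_add (le_of_eq ?_) (le_of_eq ?_)
  · rw [energy_EE h u v μ hμ, NN]
    simp only [← NN_EE hU A u v hu hv]
    rw [Finset.sum_comm, Finset.mul_sum]
    refine Finset.sum_congr rfl fun p _ => ?_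
    rw [Finset.sum_comm, Finset.mul_sum]
    refine Finset.sum_congr rfl fun q _ => ?_
    rw [← Complex.re_sum, ← Finset.mul_sum, ← Complex.re_ofReal_mul]
    congr 1
    ring
  · have hB : (Fintype.card B : ℝ) ≠ 0 := by exact_mod_cast Fintype.card_ne_zero
    have e : ∀ ω : Fin n → B × α, (Fintype.card α : ℝ) ^ 4 *
        ∑ x, Cm * (tau ρ (Function.update (XA U A ω) u (QQ U x)) *
        (θ * opNorm h ^ 2 / 2 + nsq (rr ρ (Function.update (XA U A ω) u (QQ U x)) v
          - rr ρ (XA U A ω) v) / (2 * θ)))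
        = ((Fintype.card α : ℝ) ^ 4 * Cm * Fintype.card B * (θ * opNorm h ^ 2 / 2)) *
            tau ρ (XA U A ω) +
          ((Fintype.card α : ℝ) ^ 4 * Cm * Fintype.card B / (2 * θ)) *
            ((Fintype.card B : ℝ)⁻¹ * ∑ x,
              tau ρ (Function.update (XA U A ω) u (QQ U x)) *
              nsq (rr ρ (Function.update (XA U A ω) u (QQ U x)) v - rr ρ (XA U A ω) v)) := by
      intro ω
      have h1 := sum_tau_upd (ρ := ρ) hU (XA U A ω) u (by simp [XA, hu])
      have h2 : ((Fintype.card α : ℝ) ^ 4 * Cm * Fintype.card B * (θ * opNorm h ^ 2 / 2)) *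
            tau ρ (XA U A ω) = ((Fintype.card α : ℝ) ^ 4 * Cm * (θ * opNorm h ^ 2 / 2)) *
            (Fintype.card B * tau ρ (XA U A ω)) := by ring
      rw [h2, ← h1]
      have h3 : ∀ S : ℝ, ((Fintype.card α : ℝ) ^ 4 * Cm * Fintype.card B / (2 * θ)) *
            ((Fintype.card B : ℝ)⁻¹ * S) = ((Fintype.card α : ℝ) ^ 4 * Cm / (2 * θ)) * S := by
        intro S; field_simp
      rw [h3, Finset.mul_sum, Finset.mul_sum, Finset.mul_sum, ← Finset.sum_add_distrib]
      exact Finset.sum_congr rfl fun x _ => by ring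
    simp only [e]
    rw [NN_add, NN_mul, NN_mul, NN_tau hU hρ, DD]
    ring

lemma edge_any (hU : ∀ b, (U b).conjTranspose * U b = 1) (hρ : IsDensity ρ)
    (h : Matrix (Fin n → α) (Fin n → α) ℂ) (A : Finset (Fin n)) :
    NN A (fun ω => tau ρ (XA U A ω) * energy h (prodState (sg ρ U A ω))) ≤
      energy h ρ + 2 * opNorm h := by
  have h1 : NN A (fun ω => tau ρ (XA U A ω) * energy h (prodState (sg ρ U A ω)))
      ≤ NN A (fun ω => opNorm h * tau ρ (XA U A ω)) := by
    refine NN_mono A fun ω => ?_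
    rw [mul_comm]
    exact mul_le_mul_of_nonneg_right ((le_abs_self _).trans (energy_le_opNorm _ _
      (prodState_isDensity _ (sg_density hρ A ω)))) (tau_nonneg hρ (XA_psd A ω))
  rw [NN_mul, NN_tau hU hρ] at h1
  have h2 := (abs_le.1 (energy_le_opNorm h ρ hρ)).1
  linarith

end Edge

set_option linter.unusedSectionVars false

section Avg
variable {n : ℕ} {α B : Type*} [Fintype α] [DecidableEq α] [Fintype B] [Nonempty α] [Nonempty B]
variable {U : B → Matrix α α ℂ} {ρ : Matrix (Fin n → α) (Fin n → α) ℂ}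
variable {c : α → α → (B × α) → ℂ}

lemma energy_sum {m κ : Type*} [Fintype m] (E : Finset κ) (h : κ → Matrix m m ℂ)
    (ρ : Matrix m m ℂ) : energy (∑ e ∈ E, h e) ρ = ∑ e ∈ E, energy (h e) ρ := by
  simp only [energy, Matrix.sum_mul, Matrix.trace_sum, Complex.re_sum]

lemma step_A (hU : ∀ b, (U b).conjTranspose * U b = 1)
    (hc : ∀ i j, Matrix.single i j (1 : ℂ) = ∑ x, c i j x • QQ U x)
    (hρ : IsDensity ρ) (Cm : ℝ) (hCm0 : 0 ≤ Cm) (hCm : ∀ i j x, ‖c i j x‖ ≤ Cm)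
    (E : Finset (Finset (Fin n))) (h : Finset (Fin n) → Matrix (Fin n → α) (Fin n → α) ℂ)
    (hA : ∀ e ∈ E, ActsOn (h e) e) (P : Finset (Fin n) → Fin n × Fin n)
    (hP : ∀ e ∈ E, (P e).1 ≠ (P e).2 ∧ e = {(P e).1, (P e).2})
    (K : ℝ) (hK : ∀ σ : Fin n → Matrix α α ℂ, (∀ u, IsDensity (σ u)) →
      K ≤ freeEnergyFun 1 (∑ e ∈ E, h e) (prodState σ))
    (θ : ℝ) (hθ : 0 < θ) (A : Finset (Fin n)) :
    K ≤ freeEnergyFun 1 (∑ e ∈ E, h e) ρ + ∑ e ∈ E,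
      (2 * opNorm (h e) * (if (P e).1 ∈ A then (1 : ℝ) else 0) +
        2 * opNorm (h e) * (if (P e).2 ∈ A then (1 : ℝ) else 0) +
        ((Fintype.card α : ℝ) ^ 4 * Cm * Fintype.card B) *
        (θ * opNorm (h e) ^ 2 / 2 + DA ρ U (P e).1 (P e).2 A / (2 * θ))) := by
  have h1 : K = NN A (fun ω => K * tau ρ (XA U A ω)) := by
    rw [NN_mul, NN_tau hU hρ, mul_one]
  have h2 : NN A (fun ω => K * tau ρ (XA U A ω)) ≤ NN A (fun ω =>
      ∑ e ∈ E, tau ρ (XA U A ω) * energy (h e) (prodState (sg ρ U A ω)) -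
      tau ρ (XA U A ω) * ∑ u, entropy (sg ρ U A ω u)) := by
    refine NN_mono A fun ω => ?_
    have hs := sg_density (U := U) hρ A ω
    have ht := tau_nonneg hρ (XA_psd (U := U) A ω)
    have a1 := hK _ hs
    have a2 := entropy_prodState_ge _ hs
    rw [freeEnergyFun, div_one, energy_sum] at a1
    rw [← Finset.mul_sum, ← mul_sub, mul_comm]
    exact mul_le_mul_of_nonneg_left (by linarith) ht
  rw [NN_sub, NN_sum] at h2
  have h3 := entropy_avg (U := U) hU hρ A
  rw [← h1] at h2
  rw [freeEnergyFun, div_one, energy_sum]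
  have h4 : ∑ e ∈ E, NN A (fun ω => tau ρ (XA U A ω) * energy (h e) (prodState (sg ρ U A ω)))
      ≤ ∑ e ∈ E, (energy (h e) ρ +
      (2 * opNorm (h e) * (if (P e).1 ∈ A then (1 : ℝ) else 0) +
        2 * opNorm (h e) * (if (P e).2 ∈ A then (1 : ℝ) else 0) +
        ((Fintype.card α : ℝ) ^ 4 * Cm * Fintype.card B) *
        (θ * opNorm (h e) ^ 2 / 2 + DA ρ U (P e).1 (P e).2 A / (2 * θ)))) := by
    refine Finset.sum_le_sum fun e he => ?_
    have hJ := opNorm_nonneg (h e)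
    have hD := DA_nonneg (U := U) hρ (P e).1 (P e).2 A
    have hpos : 0 ≤ ((Fintype.card α : ℝ) ^ 4 * Cm * Fintype.card B) *
        (θ * opNorm (h e) ^ 2 / 2 + DA ρ U (P e).1 (P e).2 A / (2 * θ)) := by positivity
    have hany := edge_any hU hρ (h e) A
    by_cases hu : (P e).1 ∈ A
    · rw [if_pos hu]
      have : 0 ≤ 2 * opNorm (h e) * (if (P e).2 ∈ A then (1 : ℝ) else 0) := by
        split_ifs <;> simp [hJ]
      linarith
    · by_cases hv : (P e).2 ∈ A
      · rw [if_neg hu, if_pos hv]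
        linarith
      · rw [if_neg hu, if_neg hv]
        obtain ⟨hne, heq⟩ := hP e he
        have hact := hA e he
        have hal := edge_alive hU hc hρ Cm hCm (h e) (P e).1 (P e).2 hne
          (by rw [← heq]; exact hact) A hu hv θ hθ
        rw [DA, if_pos ⟨hu, hv, hne⟩]
        linarith
  rw [Finset.sum_add_distrib] at h4
  linarith

lemma sum_DA_le (hρ : IsDensity ρ) (E : Finset (Finset (Fin n)))
    (P : Finset (Fin n) → Fin n × Fin n)
    (hP : ∀ e ∈ E, (P e).1 ≠ (P e).2 ∧ e = {(P e).1, (P e).2}) (A : Finset (Fin n)) :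
    ∑ e ∈ E, DA ρ U (P e).1 (P e).2 A ≤ ∑ u, ∑ v, DA ρ U u v A := by
  rw [← Fintype.sum_prod_type' (f := fun u v => DA ρ U u v A)]
  have hinj : Set.InjOn P E := by
    intro e he e' he' hh
    rw [(hP e he).2, (hP e' he').2, hh]
  rw [← Finset.sum_image (f := fun p : Fin n × Fin n => DA ρ U p.1 p.2 A) hinj]
  exact Finset.sum_le_sum_of_subset_of_nonneg (Finset.subset_univ _)
    fun p _ _ => DA_nonneg hρ p.1 p.2 A

lemma avg_bound (hU : ∀ b, (U b).conjTranspose * U b = 1)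
    (hc : ∀ i j, Matrix.single i j (1 : ℂ) = ∑ x, c i j x • QQ U x)
    (hρ : IsDensity ρ) (Cm : ℝ) (hCm0 : 0 ≤ Cm) (hCm : ∀ i j x, ‖c i j x‖ ≤ Cm)
    (E : Finset (Finset (Fin n))) (h : Finset (Fin n) → Matrix (Fin n → α) (Fin n → α) ℂ)
    (hE : ∀ e ∈ E, e.card = 2)
    (hA : ∀ e ∈ E, ActsOn (h e) e)
    (K : ℝ) (hK : ∀ σ : Fin n → Matrix α α ℂ, (∀ u, IsDensity (σ u)) →
      K ≤ freeEnergyFun 1 (∑ e ∈ E, h e) (prodState σ))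
    (θ : ℝ) (hθ : 0 < θ) (hn : 0 < n) (l : ℕ) (hl : 1 ≤ l) :
    K ≤ freeEnergyFun 1 (∑ e ∈ E, h e) ρ + 4 * ((l : ℝ) / n * ∑ e ∈ E, opNorm (h e)) +
      ((Fintype.card α : ℝ) ^ 4 * Cm * Fintype.card B) *
        (θ / 2 * (∑ e ∈ E, opNorm (h e) ^ 2) +
          (n : ℝ) ^ 2 * (Fintype.card α : ℝ) ^ 2 / (2 * θ * l)) := by
  have : ∃ P : Finset (Fin n) → Fin n × Fin n,
      ∀ e ∈ E, (P e).1 ≠ (P e).2 ∧ e = {(P e).1, (P e).2} := by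
    have : ∀ e : Finset (Fin n), ∃ p : Fin n × Fin n, e ∈ E → p.1 ≠ p.2 ∧ e = {p.1, p.2} := by
      intro e
      by_cases he : e ∈ E
      · obtain ⟨u, v, h1, h2⟩ := Finset.card_eq_two.1 (hE e he)
        exact ⟨(u, v), fun _ => ⟨h1, h2⟩⟩
      · exact ⟨(⟨0, hn⟩, ⟨0, hn⟩), fun h => absurd h he⟩
    choose P hP using this
    exact ⟨P, hP⟩
  obtain ⟨P, hP⟩ := this
  have hn' : (0 : ℝ) < n := by exact_mod_cast hn
  have hl' : (0 : ℝ) < l := by exact_mod_cast hl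
  set K0 := (Fintype.card α : ℝ) ^ 4 * Cm * Fintype.card B with hK0
  have hK0' : 0 ≤ K0 := by positivity
  set J1 := ∑ e ∈ E, opNorm (h e) with hJ1
  set J2 := ∑ e ∈ E, opNorm (h e) ^ 2 with hJ2
  set F := freeEnergyFun 1 (∑ e ∈ E, h e) ρ with hF
  have hstep : ∀ t ∈ Finset.range l, K ≤ F + 4 * ((l : ℝ) / n * J1) + K0 * (θ / 2 * J2) +
      K0 / (2 * θ) * ES t (fun A => ∑ u, ∑ v, DA ρ U u v A) := by
    intro t ht
    have hA1 : ∀ A : Finset (Fin n), K ≤ F + K0 * (θ / 2 * J2) + (∑ e ∈ E,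
        (2 * opNorm (h e) * (if (P e).1 ∈ A then (1 : ℝ) else 0) +
         2 * opNorm (h e) * (if (P e).2 ∈ A then (1 : ℝ) else 0)) +
         K0 / (2 * θ) * ∑ u, ∑ v, DA ρ U u v A) := by
      intro A
      have s1 := step_A hU hc hρ Cm hCm0 hCm E h hA P hP K hK θ hθ A
      have s2 := mul_le_mul_of_nonneg_left (sum_DA_le (U := U) hρ E P hP A)
        (show 0 ≤ K0 / (2 * θ) by positivity)
      rw [Finset.sum_add_distrib, ← Finset.mul_sum, ← hK0, ← hF, Finset.sum_add_distrib] at s1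
      have e1 : ∑ e ∈ E, θ * opNorm (h e) ^ 2 / 2 = θ / 2 * J2 := by
        rw [hJ2, Finset.mul_sum]; exact Finset.sum_congr rfl fun e _ => by ring
      have e2 : K0 * ∑ e ∈ E, DA ρ U (P e).1 (P e).2 A / (2 * θ)
          = K0 / (2 * θ) * ∑ e ∈ E, DA ρ U (P e).1 (P e).2 A := by
        rw [← Finset.sum_div]; ring
      rw [Finset.sum_add_distrib, e1, mul_add, e2] at s1
      rw [Finset.sum_add_distrib]
      linarith
    have hES := ES_mono (n := n) t hA1
    rw [ES_const hn, ES_add, ES_const hn, ES_add, ES_sum, ES_mul] at hES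
    have hb : ∑ e ∈ E, ES t (fun A => (2 * opNorm (h e) * (if (P e).1 ∈ A then (1 : ℝ) else 0) +
         2 * opNorm (h e) * (if (P e).2 ∈ A then (1 : ℝ) else 0))) ≤ 4 * ((l : ℝ) / n * J1) := by
      rw [hJ1, Finset.mul_sum, Finset.mul_sum]
      refine Finset.sum_le_sum fun e _ => ?_
      rw [ES_add, ES_mul, ES_mul]
      have hJ := opNorm_nonneg (h e)
      have htl : (t : ℝ) / n ≤ l / n := by
        gcongr
        exact (Finset.mem_range.1 ht).le
      have m1 := mul_le_mul_of_nonneg_left ((ES_mem hn t (P e).1).trans htl)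
        (show 0 ≤ 2 * opNorm (h e) by positivity)
      have m2 := mul_le_mul_of_nonneg_left ((ES_mem hn t (P e).2).trans htl)
        (show 0 ≤ 2 * opNorm (h e) by positivity)
      linarith
    linarith
  have hsum := Finset.sum_le_sum hstep
  rw [Finset.sum_add_distrib, ← Finset.mul_sum] at hsum
  simp only [Finset.sum_const, Finset.card_range, nsmul_eq_mul] at hsum
  have hphi := mul_le_mul_of_nonneg_left (ES_phi (U := U) hU hρ hn l)
    (show 0 ≤ K0 / (2 * θ) by positivity)
  have hfin : (l : ℝ) * K ≤ l * (F + 4 * ((l : ℝ) / n * J1) + K0 *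
        (θ / 2 * J2 + (n : ℝ) ^ 2 * (Fintype.card α : ℝ) ^ 2 / (2 * θ * l))) := by
    have : (l : ℝ) * (F + 4 * ((l : ℝ) / n * J1) + K0 *
        (θ / 2 * J2 + (n : ℝ) ^ 2 * (Fintype.card α : ℝ) ^ 2 / (2 * θ * l)))
        = l * (F + 4 * ((l : ℝ) / n * J1) + K0 * (θ / 2 * J2)) +
          K0 / (2 * θ) * ((n : ℝ) ^ 2 * (Fintype.card α : ℝ) ^ 2) := by
      field_simp
      ring
    linarith
  exact le_of_mul_le_mul_left hfin hl'

end Avg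

section Fin
variable {n : ℕ} {α : Type*} [Fintype α] [DecidableEq α] [Nonempty α]

lemma entropy_le_max {m : Type*} [Fintype m] [DecidableEq m] [Nonempty m] {ρ : Matrix m m ℂ}
    (hρ : IsDensity ρ) : entropy ρ ≤ Real.log (Fintype.card m) := by
  have hc : (Fintype.card m : ℝ) ≠ 0 := by exact_mod_cast Fintype.card_ne_zero
  have h := entropy_le hρ 1 (by simp) (fun _ => (Fintype.card m : ℝ)⁻¹) (fun _ => by positivity)
    (by simp [hc]) (fun j hj => absurd hj (inv_ne_zero hc))
  rw [← Finset.sum_mul, ← Complex.re_sum, ← Matrix.trace_sum, ← Matrix.mul_sum,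
    sum_pj _ (by simp), Matrix.mul_one, hρ.2, Real.log_inv] at h
  simpa using h

lemma entropy_mm : Real.log (Fintype.card α) ≤ entropy (mm α) := by
  have hc : (Fintype.card α : ℝ) ≠ 0 := by exact_mod_cast Fintype.card_ne_zero
  have h := entropy_ge (mm_density (α := α)) 1 (by simp) (fun _ => (Fintype.card α : ℝ)⁻¹)
    (fun _ => by positivity) (by simp [mm, Matrix.smul_one_eq_diagonal])
  simpa [hc] using h

lemma entropy_max_prod {ρ : Matrix (Fin n → α) (Fin n → α) ℂ} (hρ : IsDensity ρ) :
    entropy ρ ≤ entropy (prodState (fun _ : Fin n => mm α)) := by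
  have h1 := entropy_le_max hρ
  have h2 := entropy_prodState_ge (fun _ : Fin n => mm α) (fun _ => mm_density)
  have h3 := entropy_mm (α := α)
  simp only [Finset.sum_const, Finset.card_univ, Fintype.card_fin, nsmul_eq_mul] at h2
  have h4 : Real.log (Fintype.card (Fin n → α)) = n * Real.log (Fintype.card α) := by
    simp [Real.log_pow]
  have h5 : (n : ℝ) * Real.log (Fintype.card α) ≤ n * entropy (mm α) :=
    mul_le_mul_of_nonneg_left h3 (by positivity)
  linarith

lemma f_bdd (H : Matrix (Fin n → α) (Fin n → α) ℂ) :
    BddBelow {x : ℝ | ∃ ρ, IsDensity ρ ∧ x = freeEnergyFun 1 H ρ} := by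
  refine ⟨-opNorm H - Real.log (Fintype.card (Fin n → α)), ?_⟩
  rintro x ⟨ρ, hρ, rfl⟩
  have h1 := (abs_le.1 (energy_le_opNorm H ρ hρ)).1
  have h2 := entropy_le_max hρ
  rw [freeEnergyFun, div_one]
  linarith

lemma opNorm_eq_zero {m : Type*} [Fintype m] [DecidableEq m] {A : Matrix m m ℂ}
    (h : opNorm A = 0) : A = 0 := by
  ext i j
  have := entry_le_opNorm A i j
  rw [h] at this
  simpa using this

end Fin

/-- For every fixed local dimension `d` there is a constant `C` such that for
every 2-local Hamiltonian `H` on `n` qudits of local dimension `d` (inverse temperature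
absorbed, `β = 1`) and every integer `1 ≤ l ≤ n`, there exists a product mixed state `σ` with
`f(σ) ≥ F ≥ f(σ) − C·((l/n)·|J|₁ + (n/√l)·‖J‖_F)`, where `J_e = ‖h_e‖_∞`. -/
theorem product_state_free_energy_2local :
    ∀ d : ℕ, 0 < d → ∃ C : ℝ, 0 < C ∧
      ∀ (n : ℕ) (E : Finset (Finset (Fin n)))
        (h : Finset (Fin n) → Matrix (Fin n → Fin d) (Fin n → Fin d) ℂ),
        (∀ e ∈ E, e.card = 2) →
        (∀ e ∈ E, (h e).IsHermitian) →
        (∀ e ∈ E, ActsOn (h e) e) →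
        ∀ l : ℕ, 1 ≤ l → l ≤ n →
        ∃ σ : Fin n → Matrix (Fin d) (Fin d) ℂ, (∀ u, IsDensity (σ u)) ∧
          freeEnergy 1 (∑ e ∈ E, h e) ≤ freeEnergyFun 1 (∑ e ∈ E, h e) (prodState σ) ∧
          freeEnergyFun 1 (∑ e ∈ E, h e) (prodState σ) -
              C * (((l : ℝ) / n) * (∑ e ∈ E, opNorm (h e)) +
                ((n : ℝ) / Real.sqrt l) * Real.sqrt (∑ e ∈ E, (opNorm (h e)) ^ 2)) ≤
            freeEnergy 1 (∑ e ∈ E, h e) := by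
  intro d hd
  haveI : Nonempty (Fin d) := ⟨⟨0, hd⟩⟩
  obtain ⟨U, c, hU, hc⟩ := tomo (Fin d)
  obtain ⟨Cm, hCm0, hCm⟩ : ∃ Cm : ℝ, 0 ≤ Cm ∧ ∀ i j x, ‖c i j x‖ ≤ Cm := by
    refine ⟨∑ i, ∑ j, ∑ x, ‖c i j x‖, by positivity, fun i j x => ?_⟩
    refine le_trans ?_ (Finset.single_le_sum (f := fun i => ∑ j, ∑ x, ‖c i j x‖)
      (fun i _ => by positivity) (Finset.mem_univ i))
    refine le_trans ?_ (Finset.single_le_sum (f := fun j => ∑ x, ‖c i j x‖)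
      (fun i _ => by positivity) (Finset.mem_univ j))
    exact Finset.single_le_sum (f := fun x => ‖c i j x‖)
      (fun i _ => by positivity) (Finset.mem_univ x)
  set K0 := (Fintype.card (Fin d) : ℝ) ^ 4 * Cm * Fintype.card (Fin d × Fin d × Bool) with hK0
  have hK0' : 0 ≤ K0 := by positivity
  set D : ℝ := (Fintype.card (Fin d) : ℝ) ^ 2 with hD
  have hD' : 0 ≤ D := by positivity
  refine ⟨5 + K0 * (1 + D), by positivity, ?_⟩
  intro n E h hE _hH hA l hl hln
  have hn : 0 < n := by omega
  have hn' : (0 : ℝ) < n := by exact_mod_cast hn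
  have hl' : (0 : ℝ) < l := by exact_mod_cast hl
  have hbdd := f_bdd (∑ e ∈ E, h e)
  have hle : ∀ ρ, IsDensity ρ →
      freeEnergy 1 (∑ e ∈ E, h e) ≤ freeEnergyFun 1 (∑ e ∈ E, h e) ρ :=
    fun ρ hρ => csInf_le hbdd ⟨ρ, hρ, rfl⟩
  have hmm : ∀ u : Fin n, IsDensity ((fun _ => mm (Fin d)) u) := fun _ => mm_density
  have hne : {x : ℝ | ∃ ρ, IsDensity ρ ∧ x = freeEnergyFun 1 (∑ e ∈ E, h e) ρ}.Nonempty :=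
    ⟨_, _, prodState_isDensity _ hmm, rfl⟩
  have hJ1 : 0 ≤ ∑ e ∈ E, opNorm (h e) := Finset.sum_nonneg fun e _ => opNorm_nonneg _
  have hJ2 : 0 ≤ ∑ e ∈ E, opNorm (h e) ^ 2 := Finset.sum_nonneg fun e _ => by positivity
  rcases hJ2.eq_or_lt with h0 | hpos
  · have hz : ∀ e ∈ E, h e = 0 := by
      intro e he
      have := (Finset.sum_eq_zero_iff_of_nonneg (fun e _ => by positivity)).1 h0.symm e he
      exact opNorm_eq_zero (pow_eq_zero_iff two_ne_zero |>.1 this)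
    have hH0 : ∑ e ∈ E, h e = 0 := Finset.sum_eq_zero hz
    refine ⟨fun _ => mm (Fin d), hmm, hle _ (prodState_isDensity _ hmm), ?_⟩
    refine le_csInf hne ?_
    rintro x ⟨ρ, hρ, rfl⟩
    have h1 := entropy_max_prod hρ
    have h2 : 0 ≤ (5 + K0 * (1 + D)) * (((l : ℝ) / n) * (∑ e ∈ E, opNorm (h e)) +
                ((n : ℝ) / Real.sqrt l) * Real.sqrt (∑ e ∈ E, (opNorm (h e)) ^ 2)) := by
      positivity
    rw [hH0, freeEnergyFun, freeEnergyFun]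
    simp only [energy, Matrix.zero_mul, Matrix.trace_zero, Complex.zero_re, div_one, zero_sub]
    linarith
  · set s := Real.sqrt (∑ e ∈ E, opNorm (h e) ^ 2) with hs
    have hs0 : 0 < s := Real.sqrt_pos.2 hpos
    have hss : ∑ e ∈ E, opNorm (h e) ^ 2 = s ^ 2 := (Real.sq_sqrt hJ2).symm
    set r := Real.sqrt (l : ℝ) with hr
    have hr0 : 0 < r := Real.sqrt_pos.2 hl'
    have hrr : (l : ℝ) = r ^ 2 := (Real.sq_sqrt hl'.le).symm
    set L := ((l : ℝ) / n) * (∑ e ∈ E, opNorm (h e)) with hL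
    have hL0 : 0 ≤ L := by positivity
    set N := (n : ℝ) / r * s with hN
    have hN0 : 0 < N := by positivity
    set S : Set ℝ := {x | ∃ σ : Fin n → Matrix (Fin d) (Fin d) ℂ, (∀ u, IsDensity (σ u)) ∧
      x = freeEnergyFun 1 (∑ e ∈ E, h e) (prodState σ)} with hS
    have hSne : S.Nonempty := ⟨_, _, hmm, rfl⟩
    have hSb : BddBelow S := hbdd.mono (by
      rintro x ⟨σ, hσ, rfl⟩
      exact ⟨_, prodState_isDensity _ hσ, rfl⟩)
    obtain ⟨_, ⟨σ, hσ, rfl⟩, hlt⟩ := exists_lt_of_csInf_lt hSne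
      (show sInf S < sInf S + (L + N) by linarith)
    refine ⟨σ, hσ, hle _ (prodState_isDensity _ hσ), ?_⟩
    refine le_csInf hne ?_
    rintro x ⟨ρ, hρ, rfl⟩
    have key := avg_bound hU hc hρ Cm hCm0 hCm E h hE hA (sInf S)
      (fun τ hτ => csInf_le hSb ⟨τ, hτ, rfl⟩) ((n : ℝ) / (r * s)) (by positivity) hn l hl
    rw [← hK0, ← hD, ← hL, hss] at key
    have e : (n : ℝ) / (r * s) / 2 * s ^ 2 + (n : ℝ) ^ 2 * D / (2 * ((n : ℝ) / (r * s)) * l)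
        = (1 + D) / 2 * N := by
      rw [hrr, hN]
      field_simp
    rw [e] at key
    have b1 : 0 ≤ K0 * (1 + D) * L := by positivity
    have b2 : 0 ≤ K0 * (1 + D) * N := by positivity
    linarith

end QLH
end
end

section
/- Let X_1,…,X_n be random variables taking values in finite sets, with an arbitrary joint distribution, and let k, l be positive integers with l + k ≤ n. Then E_{m}\,E_{C}\,E_{u_1,…,u_k} [ I(X_{u_1} : ⋯ : X_{u_k} | X_C) ] ≤ (k²/l) · E_{u} [ I(X_u : X_{\{1,…,n\}∖\{u\}}) ], where m is uniform on {0,1,…,l}, C is a uniformly random m-element subset of {1,…,n}, (u_1,…,u_k) is a uniformly random k-tuple of distinct elements of {1,…,n}∖C, and u is uniform on {1,…,n}. -/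
open scoped BigOperators

noncomputable section

namespace CIT

variable {Ω : Type*} [Fintype Ω]

/-- Shannon entropy of the random variable `Y` on the finite probability space `(Ω, p)`. -/
def shannon {α : Type*} [Fintype α] [DecidableEq α] (p : Ω → ℝ) (Y : Ω → α) : ℝ :=
  -∑ a : α,
    (∑ ω ∈ Finset.univ.filter (fun ω => Y ω = a), p ω) *
      Real.log (∑ ω ∈ Finset.univ.filter (fun ω => Y ω = a), p ω)

/-- Conditional entropy `H(Y|Z) = H(Y,Z) − H(Z)`. -/
def condEnt {α β : Type*} [Fintype α] [DecidableEq α] [Fintype β] [DecidableEq β]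
    (p : Ω → ℝ) (Y : Ω → α) (Z : Ω → β) : ℝ :=
  shannon p (fun ω => (Y ω, Z ω)) - shannon p Z

/-- Mutual information `I(Y:Z) = H(Y) + H(Z) − H(Y,Z)`. -/
def mutInfo {α β : Type*} [Fintype α] [DecidableEq α] [Fintype β] [DecidableEq β]
    (p : Ω → ℝ) (Y : Ω → α) (Z : Ω → β) : ℝ :=
  shannon p Y + shannon p Z - shannon p (fun ω => (Y ω, Z ω))

/-- Multipartite conditional mutual information
`I(X_{u 0} : ⋯ : X_{u (k−1)} | X_C) = ∑_i H(X_{u i}|X_C) − H(X_{u 0},…,X_{u(k−1)}|X_C)`. -/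
def mCMI {V : Type*} [Fintype V] [DecidableEq V] {n k : ℕ}
    (p : Ω → ℝ) (X : Fin n → Ω → V) (u : Fin k → Fin n) (C : Finset (Fin n)) : ℝ :=
  (∑ i, condEnt p (X (u i)) (fun ω (v : {x // x ∈ C}) => X v.1 ω)) -
    condEnt p (fun ω (i : Fin k) => X (u i) ω) (fun ω (v : {x // x ∈ C}) => X v.1 ω)

/-- Probability of the `Y`-fibre through `ω`. -/
def fib {α : Type*} [DecidableEq α] (p : Ω → ℝ) (Y : Ω → α) (ω : Ω) : ℝ :=
  ∑ ω' ∈ Finset.univ.filter (fun ω' => Y ω' = Y ω), p ω'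

lemma shannon_eq {α : Type*} [Fintype α] [DecidableEq α] (p : Ω → ℝ) (Y : Ω → α) :
    shannon p Y = -∑ ω, p ω * Real.log (fib p Y ω) := by
  unfold shannon
  congr 1
  rw [← Finset.sum_fiberwise (s := Finset.univ) (g := Y)]
  refine Finset.sum_congr rfl fun a _ => ?_
  rw [Finset.sum_mul]
  refine Finset.sum_congr rfl fun ω hω => ?_
  simp only [Finset.mem_filter, Finset.mem_univ, true_and] at hω
  simp only [fib, hω]

lemma shannon_congr {α β : Type*} [Fintype α] [DecidableEq α] [Fintype β] [DecidableEq β]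
    (p : Ω → ℝ) (Y : Ω → α) (Z : Ω → β) (h : ∀ ω ω', Y ω = Y ω' ↔ Z ω = Z ω') :
    shannon p Y = shannon p Z := by
  rw [shannon_eq, shannon_eq]
  simp only [fib, h]

/-- Submodularity of entropy. -/
lemma submod {α β γ : Type*} [Fintype α] [DecidableEq α] [Fintype β] [DecidableEq β]
    [Fintype γ] [DecidableEq γ] (p : Ω → ℝ) (hp0 : ∀ ω, 0 ≤ p ω)
    (A : Ω → α) (B : Ω → β) (C : Ω → γ) :
    shannon p (fun ω => ((A ω, B ω), C ω)) + shannon p C ≤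
      shannon p (fun ω => (A ω, C ω)) + shannon p (fun ω => (B ω, C ω)) := by
  classical
  let q : (α × β) × γ → ℝ := fun t =>
    ∑ ω' ∈ Finset.univ.filter (fun ω' => ((A ω', B ω'), C ω') = t), p ω'
  let qa : α × γ → ℝ := fun t =>
    ∑ ω' ∈ Finset.univ.filter (fun ω' => (A ω', C ω') = t), p ω'
  let qb : β × γ → ℝ := fun t =>
    ∑ ω' ∈ Finset.univ.filter (fun ω' => (B ω', C ω') = t), p ω'
  let qc : γ → ℝ := fun t =>
    ∑ ω' ∈ Finset.univ.filter (fun ω' => C ω' = t), p ω'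
  have hq0 : ∀ t, 0 ≤ q t := fun t => Finset.sum_nonneg fun _ _ => hp0 _
  have hqa0 : ∀ t, 0 ≤ qa t := fun t => Finset.sum_nonneg fun _ _ => hp0 _
  have hqb0 : ∀ t, 0 ≤ qb t := fun t => Finset.sum_nonneg fun _ _ => hp0 _
  have hqc0 : ∀ t, 0 ≤ qc t := fun t => Finset.sum_nonneg fun _ _ => hp0 _
  have hsa : ∀ c, ∑ a, qa (a, c) = qc c := by
    intro c
    have := Finset.sum_fiberwise (Finset.univ.filter (fun ω' => C ω' = c)) A p
    simp only [qa, qc, ← this, Finset.filter_filter, Prod.mk.injEq]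
    refine Finset.sum_congr rfl fun a _ => Finset.sum_congr ?_ fun _ _ => rfl
    ext; simp [and_comm]
  have hsb : ∀ c, ∑ a, qb (a, c) = qc c := by
    intro c
    have := Finset.sum_fiberwise (Finset.univ.filter (fun ω' => C ω' = c)) B p
    simp only [qb, qc, ← this, Finset.filter_filter, Prod.mk.injEq]
    refine Finset.sum_congr rfl fun a _ => Finset.sum_congr ?_ fun _ _ => rfl
    ext; simp [and_comm]
  have hsc : ∑ c, qc c = ∑ ω, p ω := Finset.sum_fiberwise Finset.univ C p
  -- the reference sum
  have hkey : ∑ ω, p ω * (qa (A ω, C ω) * qb (B ω, C ω) /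
      (q ((A ω, B ω), C ω) * qc (C ω))) ≤ ∑ ω, p ω := by
    rw [← Finset.sum_fiberwise (s := Finset.univ) (g := fun ω => ((A ω, B ω), C ω))]
    calc _ ≤ ∑ t : (α × β) × γ, qa (t.1.1, t.2) * qb (t.1.2, t.2) / qc t.2 := by
            refine Finset.sum_le_sum fun t _ => ?_
            have : ∑ ω ∈ Finset.univ.filter (fun ω => ((A ω, B ω), C ω) = t),
                p ω * (qa (A ω, C ω) * qb (B ω, C ω) / (q ((A ω, B ω), C ω) * qc (C ω)))
                = q t * (qa (t.1.1, t.2) * qb (t.1.2, t.2) / (q t * qc t.2)) := by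
              simp only [q]
              rw [Finset.sum_mul]
              refine Finset.sum_congr rfl fun ω hω => ?_
              simp only [Finset.mem_filter, Finset.mem_univ, true_and] at hω
              subst hω
              rfl
            rw [this]
            by_cases h : q t = 0
            · rw [h, zero_mul]
              exact div_nonneg (mul_nonneg (hqa0 _) (hqb0 _)) (hqc0 _)
            · apply le_of_eq
              rw [mul_div_assoc', mul_div_mul_left _ _ h]
      _ = ∑ c, ∑ a, ∑ b, qa (a, c) * qb (b, c) / qc c := by
            rw [Fintype.sum_prod_type_right]
            refine Finset.sum_congr rfl fun c _ => ?_
            rw [Fintype.sum_prod_type]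
      _ ≤ ∑ c, qc c := by
            refine Finset.sum_le_sum fun c _ => ?_
            simp only [← Finset.sum_div]
            rw [← Finset.sum_mul_sum, hsa, hsb]
            by_cases h : qc c = 0
            · simp [h]
            · rw [mul_div_assoc, div_self h, mul_one]
      _ = _ := hsc
  rw [shannon_eq, shannon_eq, shannon_eq, shannon_eq]
  have hterm : ∀ ω, p ω * (1 - qa (A ω, C ω) * qb (B ω, C ω) /
      (q ((A ω, B ω), C ω) * qc (C ω))) ≤
      p ω * Real.log (q ((A ω, B ω), C ω)) + p ω * Real.log (qc (C ω))
      - p ω * Real.log (qa (A ω, C ω)) - p ω * Real.log (qb (B ω, C ω)) := by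
    intro ω
    rcases (hp0 ω).eq_or_lt with h | h
    · simp [← h]
    have h1 : 0 < q ((A ω, B ω), C ω) := h.trans_le
      (Finset.single_le_sum (f := p) (fun i _ => hp0 i) (by simp))
    have h2 : 0 < qa (A ω, C ω) := h.trans_le
      (Finset.single_le_sum (f := p) (fun i _ => hp0 i) (by simp))
    have h3 : 0 < qb (B ω, C ω) := h.trans_le
      (Finset.single_le_sum (f := p) (fun i _ => hp0 i) (by simp))
    have h4 : 0 < qc (C ω) := h.trans_le
      (Finset.single_le_sum (f := p) (fun i _ => hp0 i) (by simp))
    have := Real.log_le_sub_one_of_pos (div_pos (mul_pos h2 h3) (mul_pos h1 h4))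
    rw [Real.log_div (mul_pos h2 h3).ne' (mul_pos h1 h4).ne', Real.log_mul h2.ne' h3.ne',
      Real.log_mul h1.ne' h4.ne'] at this
    have := mul_le_mul_of_nonneg_left this h.le
    linarith
  have hs := Finset.sum_le_sum fun ω (_ : ω ∈ Finset.univ) => hterm ω
  simp only [Finset.sum_sub_distrib, Finset.sum_add_distrib, mul_sub, mul_one] at hs
  have e1 : ∀ ω, fib p (fun ω => ((A ω, B ω), C ω)) ω = q ((A ω, B ω), C ω) := fun _ => rfl
  have e2 : ∀ ω, fib p (fun ω => (A ω, C ω)) ω = qa (A ω, C ω) := fun _ => rfl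
  have e3 : ∀ ω, fib p (fun ω => (B ω, C ω)) ω = qb (B ω, C ω) := fun _ => rfl
  have e4 : ∀ ω, fib p C ω = qc (C ω) := fun _ => rfl
  simp only [e1, e2, e3, e4]
  linarith

/-- Entropy of the subfamily indexed by `S`. -/
def ent {V : Type*} [Fintype V] [DecidableEq V] {n : ℕ}
    (p : Ω → ℝ) (X : Fin n → Ω → V) (S : Finset (Fin n)) : ℝ :=
  shannon p (fun ω (v : {x // x ∈ S}) => X v.1 ω)

lemma mCMI_eq {V : Type*} [Fintype V] [DecidableEq V] {n k : ℕ}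
    (p : Ω → ℝ) (X : Fin n → Ω → V) (u : Fin k → Fin n) (C : Finset (Fin n)) :
    mCMI p X u C = (∑ i, (ent p X (insert (u i) C) - ent p X C)) -
      (ent p X (C ∪ Finset.univ.image u) - ent p X C) := by
  unfold mCMI condEnt ent
  congr 1
  · refine Finset.sum_congr rfl fun i _ => ?_
    congr 1
    apply shannon_congr
    intro ω ω'
    simp [funext_iff]
  · congr 1
    apply shannon_congr
    intro ω ω'
    simp only [Prod.mk.injEq, funext_iff, Subtype.forall, Finset.mem_union, Finset.mem_image,
      Finset.mem_univ, true_and]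
    constructor
    · rintro ⟨h1, h2⟩ a (h | ⟨i, rfl⟩)
      · exact h2 a h
      · exact h1 i
    · intro h
      exact ⟨fun i => h _ (Or.inr ⟨i, rfl⟩), fun a ha => h a (Or.inl ha)⟩

lemma mCMI_two_nonneg {V : Type*} [Fintype V] [DecidableEq V] {n : ℕ}
    (p : Ω → ℝ) (hp0 : ∀ ω, 0 ≤ p ω) (X : Fin n → Ω → V) (u : Fin 2 → Fin n)
    (C : Finset (Fin n)) : 0 ≤ mCMI p X u C := by
  have := submod p hp0 (X (u 0)) (X (u 1)) (fun ω (v : {x // x ∈ C}) => X v.1 ω)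
  unfold mCMI condEnt
  rw [Fin.sum_univ_two]
  have h2 : shannon p (fun ω => ((fun i : Fin 2 => X (u i) ω),
      fun (v : {x // x ∈ C}) => X v.1 ω)) = shannon p (fun ω => ((X (u 0) ω, X (u 1) ω),
      fun (v : {x // x ∈ C}) => X v.1 ω)) := by
    apply shannon_congr
    intro ω ω'
    simp [funext_iff, Fin.forall_fin_two]
  rw [h2]
  linarith

lemma mutInfo_eq {V : Type*} [Fintype V] [DecidableEq V] {n : ℕ}
    (p : Ω → ℝ) (X : Fin n → Ω → V) (v : Fin n) :
    mutInfo p (X v) (fun ω (w : {x // x ∈ Finset.univ.erase v}) => X w.1 ω) =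
      ent p X {v} + ent p X (Finset.univ.erase v) - ent p X Finset.univ := by
  unfold mutInfo ent
  congr 1
  · congr 1
    apply shannon_congr
    intro ω ω'
    simp [funext_iff]
  · apply shannon_congr
    intro ω ω'
    simp only [Prod.mk.injEq, funext_iff, Subtype.forall, Finset.mem_erase, Finset.mem_univ,
      and_true, true_implies]
    constructor
    · rintro ⟨h1, h2⟩ a
      by_cases h : a = v
      · rw [h, h1]
      · exact h2 a h
    · intro h
      exact ⟨h v, fun a _ => h a⟩

lemma ent_empty {V : Type*} [Fintype V] [DecidableEq V] {n : ℕ}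
    (p : Ω → ℝ) (hp1 : ∑ ω, p ω = 1) (X : Fin n → Ω → V) : ent p X ∅ = 0 := by
  unfold ent
  rw [shannon_eq]
  have : ∀ ω, fib p (fun ω (v : {x // x ∈ (∅ : Finset (Fin n))}) => X v.1 ω) ω = 1 := by
    intro ω
    simp [fib, funext_iff, hp1]
  simp [this]

/-- Average of `g` over the `m`-subsets. -/
def avg {n : ℕ} (g : Finset (Fin n) → ℝ) (m : ℕ) : ℝ :=
  ((Finset.univ.filter (fun C : Finset (Fin n) => C.card = m)).card : ℝ)⁻¹ *
    ∑ C ∈ Finset.univ.filter (fun C : Finset (Fin n) => C.card = m), g C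

lemma exists_perm {n : ℕ} (S T : Finset (Fin n)) (h : S.card = T.card) :
    ∃ σ : Equiv.Perm (Fin n), S.image σ = T := by
  let e : {x // x ∈ S} ≃ {x // x ∈ T} := Finset.equivOfCardEq h
  refine ⟨e.extendSubtype, ?_⟩
  apply Finset.eq_of_subset_of_card_le
  · intro y hy
    obtain ⟨x, hx, rfl⟩ := Finset.mem_image.1 hy
    exact e.extendSubtype_mem x hx
  · rw [Finset.card_image_of_injective _ (Equiv.injective _), h]

lemma avg_equiv {n : ℕ} {ι : Type*} [DecidableEq ι] (P : Finset ι) (hP : P.Nonempty)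
    (act : Equiv.Perm (Fin n) → ι → ι) (hinj : ∀ σ, Function.Injective (act σ))
    (hmap : ∀ σ, ∀ x ∈ P, act σ x ∈ P) (Φ : ι → Finset (Fin n))
    (hΦ : ∀ σ x, Φ (act σ x) = (Φ x).image σ) (r : ℕ) (hr : ∀ x ∈ P, (Φ x).card = r)
    (g : Finset (Fin n) → ℝ) :
    (P.card : ℝ)⁻¹ * ∑ x ∈ P, g (Φ x) = avg g r := by
  obtain ⟨x0, hx0⟩ := hP
  have hle : ∀ S T : Finset (Fin n), S.card = T.card →
      (P.filter (fun x => Φ x = S)).card ≤ (P.filter (fun x => Φ x = T)).card := by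
    intro S T h
    obtain ⟨σ, hσ⟩ := exists_perm S T h
    refine Finset.card_le_card_of_injOn (act σ) ?_ (hinj σ).injOn
    intro x hx
    simp only [Finset.coe_filter, Set.mem_ofPred_eq] at hx ⊢
    exact ⟨hmap σ x hx.1, by rw [hΦ, hx.2, hσ]⟩
  set N := (P.filter (fun x => Φ x = Φ x0)).card with hN
  have hsum : ∀ g : Finset (Fin n) → ℝ, ∑ x ∈ P, g (Φ x) =
      N * ∑ S ∈ Finset.univ.filter (fun C : Finset (Fin n) => C.card = r), g S := by
    intro g
    rw [← Finset.sum_fiberwise_of_maps_to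
      (t := Finset.univ.filter (fun C : Finset (Fin n) => C.card = r)) (g := Φ)
      (fun x hx => by simpa using hr x hx), Finset.mul_sum]
    refine Finset.sum_congr rfl fun S hS => ?_
    simp only [Finset.mem_filter, Finset.mem_univ, true_and] at hS
    have h0 := hr x0 hx0
    have : (P.filter (fun x => Φ x = S)).card = N :=
      le_antisymm (hle _ _ (hS.trans h0.symm)) (hle _ _ (h0.trans hS.symm))
    rw [← this, ← nsmul_eq_mul, ← Finset.sum_const]
    refine Finset.sum_congr rfl fun x hx => ?_
    rw [(Finset.mem_filter.1 hx).2]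
  have h1 := hsum (fun _ => 1)
  simp only [Finset.sum_const, nsmul_eq_mul, mul_one] at h1
  have hPc : (P.card : ℝ) ≠ 0 := by
    exact_mod_cast (Finset.card_pos.2 ⟨x0, hx0⟩).ne'
  rw [h1] at hPc
  obtain ⟨hN0, hF0⟩ := mul_ne_zero_iff.1 hPc
  rw [hsum, h1]
  unfold avg
  field_simp

/-- Injective `k`-tuples avoiding `C`. -/
def tup {n : ℕ} (k : ℕ) (C : Finset (Fin n)) : Finset (Fin k → Fin n) :=
  Finset.univ.filter (fun u : Fin k → Fin n => Function.Injective u ∧ ∀ i, u i ∉ C)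

lemma tup_card {n : ℕ} (k : ℕ) (S T : Finset (Fin n)) (h : S.card = T.card) :
    (tup k S).card ≤ (tup k T).card := by
  obtain ⟨σ, rfl⟩ := exists_perm S T h
  refine Finset.card_le_card_of_injOn (fun u i => σ (u i)) ?_ ?_
  · intro u hu
    simp only [tup, Finset.coe_filter, Finset.mem_univ, true_and, Set.mem_ofPred_eq] at hu ⊢
    refine ⟨σ.injective.comp hu.1, fun i => ?_⟩
    simpa using hu.2 i
  · intro u _ v _ huv
    funext i
    exact σ.injective (congrFun huv i)

/-- The iterated average. -/
def avg2 {n : ℕ} (k m : ℕ) (G : Finset (Fin n) → (Fin k → Fin n) → ℝ) : ℝ :=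
  ((Finset.univ.filter (fun C : Finset (Fin n) => C.card = m)).card : ℝ)⁻¹ *
    ∑ C ∈ Finset.univ.filter (fun C : Finset (Fin n) => C.card = m),
      ((tup k C).card : ℝ)⁻¹ * ∑ u ∈ tup k C, G C u

lemma avg2_equiv {n k m : ℕ} (hn : m + k ≤ n)
    (Φ : Finset (Fin n) → (Fin k → Fin n) → Finset (Fin n))
    (hΦ : ∀ (σ : Equiv.Perm (Fin n)) C u, Φ (C.image σ) (fun i => σ (u i)) = (Φ C u).image σ)
    (r : ℕ) (hr : ∀ C u, C.card = m → u ∈ tup k C → (Φ C u).card = r)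
    (g : Finset (Fin n) → ℝ) :
    avg2 k m (fun C u => g (Φ C u)) = avg g r := by
  classical
  obtain ⟨C0, hC0, u0, hu0⟩ : ∃ C0 : Finset (Fin n), C0.card = m ∧ ∃ u0, u0 ∈ tup k C0 := by
    refine ⟨Finset.univ.map (Fin.castLEEmb (show m ≤ n by omega)), by simp,
      fun i => ⟨m + i, by omega⟩, ?_⟩
    simp only [tup, Finset.mem_filter, Finset.mem_univ, true_and]
    refine ⟨fun i j hij => ?_, fun i => ?_⟩
    · simp only [Fin.mk.injEq] at hij
      ext; omega
    · simp only [Finset.mem_map, Finset.mem_univ, true_and, not_exists]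
      intro x hx
      have := congrArg Fin.val hx
      simp at this
      omega
  let F := Finset.univ.filter (fun C : Finset (Fin n) => C.card = m)
  let P : Finset (Finset (Fin n) × (Fin k → Fin n)) :=
    Finset.univ.filter (fun x => x.1.card = m ∧ x.2 ∈ tup k x.1)
  have hD : ∀ C ∈ F, (tup k C).card = (tup k C0).card := by
    intro C hC
    have hC : C.card = m := by simpa [F] using hC
    exact le_antisymm (tup_card k _ _ (hC.trans hC0.symm)) (tup_card k _ _ (hC0.trans hC.symm))
  have hPs : ∀ G : Finset (Fin n) → (Fin k → Fin n) → ℝ,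
      ∑ x ∈ P, G x.1 x.2 = ∑ C ∈ F, ∑ u ∈ tup k C, G C u := by
    intro G
    exact Finset.sum_finset_product P F (fun C => tup k C) (by simp [P, F])
  have hPc : (P.card : ℝ) = F.card * (tup k C0).card := by
    have := hPs (fun _ _ => 1)
    simp only [Finset.sum_const, nsmul_eq_mul, mul_one] at this
    rw [this, Finset.sum_congr rfl (fun C hC => by rw [hD C hC]), Finset.sum_const, nsmul_eq_mul]
  have hmain := avg_equiv P ⟨(C0, u0), by simp [P, hC0, hu0]⟩
    (fun σ x => (x.1.image σ, fun i => σ (x.2 i))) ?_ ?_ (fun x => Φ x.1 x.2)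
    (fun σ x => hΦ σ x.1 x.2) r ?_ g
  · rw [← hmain, hPs (fun C u => g (Φ C u)), hPc, mul_inv, mul_assoc]
    unfold avg2
    congr 1
    rw [Finset.mul_sum]
    exact Finset.sum_congr rfl fun C hC => by rw [hD C hC]
  · intro σ x y hxy
    simp only [Prod.mk.injEq] at hxy
    refine Prod.ext (Finset.image_injective σ.injective hxy.1) ?_
    funext i
    exact σ.injective (congrFun hxy.2 i)
  · intro σ x hx
    simp only [P, tup, Finset.mem_filter, Finset.mem_univ, true_and] at hx ⊢
    refine ⟨by rw [Finset.card_image_of_injective _ σ.injective, hx.1],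
      σ.injective.comp hx.2.1, fun i => ?_⟩
    simpa using hx.2.2 i
  · intro x hx
    simp only [P, Finset.mem_filter, Finset.mem_univ, true_and] at hx
    exact hr _ _ hx.1 hx.2

lemma avg2_mCMI {V : Type*} [Fintype V] [DecidableEq V] {n k m : ℕ} (hn : m + k ≤ n)
    (p : Ω → ℝ) (X : Fin n → Ω → V) :
    avg2 k m (fun C u => mCMI p X u C) =
      (k : ℝ) * (avg (ent p X) (m + 1) - avg (ent p X) m) -
        (avg (ent p X) (m + k) - avg (ent p X) m) := by
  have h0 : avg2 k m (fun C _ => ent p X C) = avg (ent p X) m :=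
    avg2_equiv hn (fun C _ => C) (fun _ _ _ => rfl) m (fun _ _ h _ => h) _
  have hk : avg2 k m (fun C u => ent p X (C ∪ Finset.univ.image u)) = avg (ent p X) (m + k) := by
    refine avg2_equiv hn (fun C u => C ∪ Finset.univ.image u) ?_ _ ?_ _
    · intro σ C u
      rw [Finset.image_union, Finset.image_image]
      rfl
    · intro C u hC hu
      simp only [tup, Finset.mem_filter, Finset.mem_univ, true_and] at hu
      rw [Finset.card_union_of_disjoint, hC, Finset.card_image_of_injective _ hu.1]
      · simp
      · rw [Finset.disjoint_right]
        intro a ha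
        obtain ⟨i, _, rfl⟩ := Finset.mem_image.1 ha
        exact hu.2 i
  have h1 : ∀ i, avg2 k m (fun C u => ent p X (insert (u i) C)) = avg (ent p X) (m + 1) := by
    intro i
    refine avg2_equiv hn (fun C u => insert (u i) C) ?_ _ ?_ _
    · intro σ C u
      rw [Finset.image_insert]
    · intro C u hC hu
      simp only [tup, Finset.mem_filter, Finset.mem_univ, true_and] at hu
      rw [Finset.card_insert_of_notMem (hu.2 i), hC]
  have hsub : ∀ G G' : Finset (Fin n) → (Fin k → Fin n) → ℝ,
      avg2 k m (fun C u => G C u - G' C u) = avg2 k m G - avg2 k m G' := by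
    intro G G'
    simp only [avg2, Finset.sum_sub_distrib, mul_sub]
  have hsum : ∀ G : Fin k → Finset (Fin n) → (Fin k → Fin n) → ℝ,
      avg2 k m (fun C u => ∑ i, G i C u) = ∑ i, avg2 k m (G i) := by
    intro G
    simp only [avg2]
    rw [← Finset.mul_sum, Finset.sum_comm]
    congr 1
    refine Finset.sum_congr rfl fun C _ => ?_
    rw [← Finset.mul_sum, Finset.sum_comm]
  simp only [mCMI_eq]
  rw [hsub, hsub, hsum, hk, h0]
  simp only [hsub, h1, h0]
  simp
  ring

lemma real_bound (d : ℕ → ℝ) (n k l : ℕ) (hn : l + k ≤ n) (hl : 1 ≤ l)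
    (hd : ∀ i, i + 2 ≤ n → d (i + 1) ≤ d i) :
    ((l : ℝ) + 1)⁻¹ * ∑ m ∈ Finset.range (l + 1), ∑ j ∈ Finset.range k, (d m - d (m + j)) ≤
      ((k : ℝ) ^ 2 / l) * (d 0 - d (n - 1)) := by
  have hanti : ∀ i j, i ≤ j → j + 1 ≤ n → d j ≤ d i := by
    intro i j hij
    induction j, hij using Nat.le_induction with
    | base => intro _; exact le_rfl
    | succ j _ ih => intro h; exact (hd j (by omega)).trans (ih (by omega))
  have hΔ : 0 ≤ d 0 - d (n - 1) := sub_nonneg.2 (hanti _ _ (by omega) (by omega))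
  have hj : ∀ j, j < k → ∑ m ∈ Finset.range (l + 1), (d m - d (m + j)) ≤
      j * (d 0 - d (n - 1)) := by
    intro j
    induction j with
    | zero => intro _; simp
    | succ j ih =>
      intro h
      have h1 := ih (by omega)
      have h2 : ∑ m ∈ Finset.range (l + 1), (d (m + j) - d (m + 1 + j)) =
          d (0 + j) - d (l + 1 + j) :=
        Finset.sum_range_sub' (fun m => d (m + j)) (l + 1)
      have h3 : ∑ m ∈ Finset.range (l + 1), (d m - d (m + (j + 1))) =
          ∑ m ∈ Finset.range (l + 1), (d m - d (m + j)) +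
          ∑ m ∈ Finset.range (l + 1), (d (m + j) - d (m + 1 + j)) := by
        rw [← Finset.sum_add_distrib]
        refine Finset.sum_congr rfl fun m _ => ?_
        rw [show m + (j + 1) = m + 1 + j by omega]
        ring
      have h4 := hanti 0 (0 + j) (by omega) (by omega)
      have h5 := hanti (l + 1 + j) (n - 1) (by omega) (by omega)
      rw [h3, h2]
      push_cast
      linarith
  rw [Finset.sum_comm]
  have hS : ∑ j ∈ Finset.range k, ∑ m ∈ Finset.range (l + 1), (d m - d (m + j)) ≤
      (k : ℝ) ^ 2 * (d 0 - d (n - 1)) := by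
    calc _ ≤ ∑ j ∈ Finset.range k, (k : ℝ) * (d 0 - d (n - 1)) := by
            refine Finset.sum_le_sum fun j hjk => ?_
            have hjk := Finset.mem_range.1 hjk
            refine (hj j hjk).trans (mul_le_mul_of_nonneg_right ?_ hΔ)
            exact_mod_cast hjk.le
      _ = _ := by simp; ring
  have hl' : (0 : ℝ) < l := by exact_mod_cast hl
  calc _ ≤ ((l : ℝ) + 1)⁻¹ * ((k : ℝ) ^ 2 * (d 0 - d (n - 1))) :=
        mul_le_mul_of_nonneg_left hS (by positivity)
    _ ≤ (l : ℝ)⁻¹ * ((k : ℝ) ^ 2 * (d 0 - d (n - 1))) := by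
        refine mul_le_mul_of_nonneg_right ?_ (by positivity)
        exact inv_anti₀ hl' (by linarith)
    _ = _ := by ring

lemma rhs_eq {V : Type*} [Fintype V] [DecidableEq V] {n : ℕ} (hn : 1 ≤ n)
    (p : Ω → ℝ) (hp1 : ∑ ω, p ω = 1) (X : Fin n → Ω → V) :
    (n : ℝ)⁻¹ * ∑ v : Fin n,
        mutInfo p (X v) (fun ω (w : {x // x ∈ Finset.univ.erase v}) => X w.1 ω) =
      (avg (ent p X) 1 - avg (ent p X) 0) - (avg (ent p X) n - avg (ent p X) (n - 1)) := by
  have hne : (Finset.univ : Finset (Fin n)).Nonempty := ⟨⟨0, hn⟩, Finset.mem_univ _⟩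
  have key : ∀ (Φ : Fin n → Finset (Fin n)),
      (∀ (σ : Equiv.Perm (Fin n)) x, Φ (σ x) = (Φ x).image σ) →
      ∀ r, (∀ x, (Φ x).card = r) → (n : ℝ)⁻¹ * ∑ v, ent p X (Φ v) = avg (ent p X) r := by
    intro Φ h r hr
    have := avg_equiv Finset.univ hne (fun σ x => σ x) (fun σ => σ.injective)
      (fun _ _ _ => Finset.mem_univ _) Φ h r (fun x _ => hr x) (ent p X)
    simpa using this
  have h0 := key (fun _ => ∅) (by simp) 0 (by simp)
  have h1 := key (fun v => {v}) (by simp) 1 (by simp)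
  have h2 := key (fun v => Finset.univ.erase v)
    (fun σ x => by
      rw [Finset.image_erase σ.injective, Finset.image_univ_equiv]) (n - 1)
    (fun x => by simp)
  have h3 := key (fun _ => Finset.univ)
    (fun σ x => by rw [Finset.image_univ_equiv]) n (by simp)
  rw [← h0, ← h1, ← h2, ← h3]
  simp only [mutInfo_eq, Finset.sum_sub_distrib, Finset.sum_add_distrib, ent_empty p hp1]
  simp
  ring

/-- multipartite self-decoupling lemma.  For random variables
`X_1, …, X_n` with values in a finite set and an arbitrary joint distribution, and positive
integers `k, l` with `l + k ≤ n`,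
`E_m E_C E_{u_1,…,u_k} [I(X_{u_1} : ⋯ : X_{u_k} | X_C)] ≤ (k²/l) · E_u [I(X_u : X_{rest})]`,
where `m` is uniform on `{0,…,l}`, `C` is a uniform `m`-element subset of `{1,…,n}`,
`(u_1,…,u_k)` is a uniform tuple of distinct elements outside `C`, and `u` is uniform. -/
theorem multipartite_self_decoupling {V : Type*} [Fintype V] [DecidableEq V]
    (p : Ω → ℝ) (hp0 : ∀ ω, 0 ≤ p ω) (hp1 : ∑ ω, p ω = 1)
    (n k l : ℕ) (hk : 1 ≤ k) (hl : 1 ≤ l) (hn : l + k ≤ n)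
    (X : Fin n → Ω → V) :
    ((l : ℝ) + 1)⁻¹ *
        ∑ m ∈ Finset.range (l + 1),
          ((Finset.univ.filter (fun C : Finset (Fin n) => C.card = m)).card : ℝ)⁻¹ *
            ∑ C ∈ Finset.univ.filter (fun C : Finset (Fin n) => C.card = m),
              ((Finset.univ.filter (fun u : Fin k → Fin n =>
                  Function.Injective u ∧ ∀ i, u i ∉ C)).card : ℝ)⁻¹ *
                ∑ u ∈ Finset.univ.filter (fun u : Fin k → Fin n =>
                    Function.Injective u ∧ ∀ i, u i ∉ C),
                  mCMI p X u C ≤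
      ((k : ℝ) ^ 2 / l) *
        ((n : ℝ)⁻¹ *
          ∑ v : Fin n,
            mutInfo p (X v) (fun ω (w : {x // x ∈ Finset.univ.erase v}) => X w.1 ω)) := by
  have hA : ∀ m ∈ Finset.range (l + 1), avg2 k m (fun C u => mCMI p X u C) =
      ∑ j ∈ Finset.range k, ((avg (ent p X) (m + 1) - avg (ent p X) m) -
        (avg (ent p X) (m + j + 1) - avg (ent p X) (m + j))) := by
    intro m hm
    have hm := Finset.mem_range.1 hm
    rw [avg2_mCMI (by omega), Finset.sum_sub_distrib]
    have := Finset.sum_range_sub (fun j => avg (ent p X) (m + j)) k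
    simp only [← add_assoc] at this
    rw [this]
    simp
    ring
  have hb := real_bound (fun i => avg (ent p X) (i + 1) - avg (ent p X) i) n k l hn hl (by
    intro i hi
    have h1 := avg2_mCMI (k := 2) hi p X
    have h2 : 0 ≤ avg2 2 i (fun C u => mCMI p X u C) := by
      unfold avg2
      refine mul_nonneg (by positivity) (Finset.sum_nonneg fun C _ => ?_)
      exact mul_nonneg (by positivity)
        (Finset.sum_nonneg fun u _ => mCMI_two_nonneg p hp0 X u C)
    rw [h1] at h2
    push_cast at h2
    simp only [add_assoc] at h2 ⊢
    norm_num at h2 ⊢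
    linarith)
  rw [rhs_eq (by omega) p hp1 X]
  simp only [zero_add, show n - 1 + 1 = n by omega] at hb
  rw [← Finset.sum_congr rfl hA] at hb
  exact hb

end CIT
end
end
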